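/- arXiv:2508.09739 — 2 statements merged into one kernel-verified Lean document; each statement's English description precedes it below -/
import Mathlib

section
/- Let p be an odd prime. There exist a field F containing ℂ (i.e. equipped with a ℂ-algebra structure) and a continuous homomorphism ρ : Gal(F_s/F) → U_3(𝔽_p) that admits no lift to a continuous homomorphism Gal(F_s/F) → U_3(ℤ/p²) along the reduction ℤ/p² → ℤ/p; in particular the map H^1(Gal(F_s/F), U_3(ℤ/p²)) → H^1(Gal(F_s/F), U_3(𝔽_p)) is not surjective. -/
open scoped MatrixGroups

/-- The absolute Galois group `Gal(F_s/F)`, with its Krull topology. -/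
abbrev AbsGal (F : Type) [Field F] : Type :=
  SeparableClosure F ≃ₐ[F] SeparableClosure F

/-- A matrix in `GL_d(R)` is upper triangular (i.e. lies in the Borel `B_d(R)`). -/
def IsUpperTri {d : ℕ} {R : Type} [CommRing R] (g : GL (Fin d) R) : Prop :=
  ∀ i j : Fin d, j < i → (g : Matrix (Fin d) (Fin d) R) i j = 0

/-- A matrix in `GL_d(R)` is upper unitriangular (i.e. lies in `U_d(R)`). -/
def IsUniTri {d : ℕ} {R : Type} [CommRing R] (g : GL (Fin d) R) : Prop :=
  IsUpperTri g ∧ ∀ i : Fin d, (g : Matrix (Fin d) (Fin d) R) i i = 1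

section InvariantNormalization

variable {k R H : Type*} [Field k] [CommRing R] [Algebra k R] [Group H] [MulSemiringAction H R]

/-- The action of a group of ring automorphisms on classes of associated elements. -/
instance associatesMulAction : MulAction H (Associates R) where
  smul h := Quotient.map (h • ·) fun _ _ hab => hab.map (MulSemiringAction.toRingHom H R h)
  one_smul D := by
    induction D using Quotient.inductionOn with
    | h a => exact congrArg Associates.mk (one_smul H a)
  mul_smul g h D := by
    induction D using Quotient.inductionOn with
    | h a => exact congrArg Associates.mk (mul_smul g h a)

theorem associates_smul_mk (h : H) (a : R) : h • Associates.mk a = Associates.mk (h • a) := rfl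

theorem associates_smul_mul (h : H) (D E : Associates R) : h • (D * E) = h • D * h • E := by
  obtain ⟨a, rfl⟩ := Associates.mk_surjective D
  obtain ⟨b, rfl⟩ := Associates.mk_surjective E
  simp only [Associates.mk_mul_mk, associates_smul_mk, smul_mul']

theorem associates_smul_prod (h : H) (s : Multiset (Associates R)) :
    h • s.prod = (s.map (h • ·)).prod := by
  induction s using Multiset.induction_on with
  | empty => simp [← Associates.mk_one, associates_smul_mk]
  | cons D s ih => rw [Multiset.prod_cons, associates_smul_mul, ih, Multiset.map_cons,
      Multiset.prod_cons]

/-- If every unit is an invariant constant and the group has exponent dividing `p`, then the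
classes of associated elements have representatives permuted by the group up to `p`-th roots
of unity. -/
theorem exists_representatives [IsDomain R] {p : ℕ} (hexp : ∀ h : H, h ^ p = 1)
    (hk : ∀ (h : H) (c : k), h • algebraMap k R c = algebraMap k R c)
    (hU : ∀ u : Rˣ, ∃ c : k, algebraMap k R c = u) :
    ∃ n : Associates R → R, (∀ D, Associates.mk (n D) = D) ∧
      ∀ (h : H) (D), D ≠ 0 → ∃ c : k, c ^ p = 1 ∧ h • n D = algebraMap k R c * n (h • D) := by
  have key : ∀ D : Associates R, ∃ h : H,
      h • (Quotient.out (Quotient.mk (MulAction.orbitRel H (Associates R)) D)) = D := by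
    intro D
    have := Quotient.mk_out (s := MulAction.orbitRel H (Associates R)) D
    obtain ⟨h, hh⟩ := (MulAction.orbitRel H (Associates R)).symm this
    exact ⟨h, hh⟩
  choose t ht using key
  set b : Associates R → Associates R := fun D =>
    Quotient.out (Quotient.mk (MulAction.orbitRel H (Associates R)) D) with hb
  have hbs : ∀ (h : H) D, b (h • D) = b D := by
    intro h D
    have : (Quotient.mk (MulAction.orbitRel H (Associates R)) (h • D)) =
      Quotient.mk (MulAction.orbitRel H (Associates R)) D :=
      Quotient.sound (s := MulAction.orbitRel H (Associates R)) ⟨h, rfl⟩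
    simp only [hb, this]
  have hmk : ∀ D : Associates R, Associates.mk (Quotient.out D) = D := fun D => Quotient.out_eq D
  refine ⟨fun D => t D • Quotient.out (b D), fun D => ?_, fun h D hD => ?_⟩
  · rw [← associates_smul_mk, hmk]; exact ht D
  · set f := Quotient.out (b D) with hf
    have hD0 : t D • b D = D := ht D
    have hD1 : t (h • D) • b D = h • D := by rw [← hbs h D]; exact ht (h • D)
    have hbD : Associates.mk f = b D := hmk _
    have hf0 : f ≠ 0 := by
      intro h0
      apply hD
      rw [← hD0, ← hbD, associates_smul_mk, h0, smul_zero, Associates.mk_zero]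
    set g : H := (t (h • D))⁻¹ * (h * t D) with hg
    have hgf : Associates.mk (g • f) = Associates.mk f := by
      rw [← associates_smul_mk, hbD, hg, mul_smul, mul_smul, hD0, inv_smul_eq_iff]; exact hD1.symm
    obtain ⟨u, hu⟩ := (Associates.mk_eq_mk_iff_associated.1 hgf).symm
    obtain ⟨c, hc⟩ := hU u
    have hgc : g • f = algebraMap k R c * f := by rw [← hu, hc, mul_comm]
    have hpow : ∀ m : ℕ, g ^ m • f = algebraMap k R (c ^ m) * f := by
      intro m
      induction m with
      | zero => simp
      | succ m ih => rw [pow_succ', mul_smul, ih, smul_mul', hk, hgc, pow_succ, map_mul, mul_assoc]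
    refine ⟨c, ?_, ?_⟩
    · have := hpow p
      rw [hexp, one_smul] at this
      have h1 : algebraMap k R (c ^ p) = 1 :=
        mul_right_cancel₀ hf0 (by rw [← this, one_mul])
      exact FaithfulSMul.algebraMap_injective k R (h1.trans (map_one _).symm)
    · have : h * t D = t (h • D) * g := by rw [hg, mul_inv_cancel_left]
      change h • t D • f = _ * t (h • D) • Quotient.out (b (h • D))
      rw [hbs, ← mul_smul, this, mul_smul, hgc, smul_mul', hk]

open UniqueFactorizationMonoid in
theorem associates_normalizedFactors_smul [IsDomain R] [UniqueFactorizationMonoid R]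
    (h : H) {D : Associates R} (hD : D ≠ 0) :
    normalizedFactors (h • D) = (normalizedFactors D).map (h • ·) := by
  have h1 : (normalizedFactors D).prod = D := by
    have := prod_normalizedFactors hD
    exact associated_iff_eq.1 this
  conv_lhs => rw [← h1, associates_smul_prod]
  apply normalizedFactors_prod_of_prime
  intro q hq
  obtain ⟨P, hP, rfl⟩ := Multiset.mem_map.1 hq
  have hPp := prime_of_normalized_factor P hP
  obtain ⟨a, rfl⟩ := Associates.mk_surjective P
  rw [Associates.prime_mk] at hPp
  change Prime (Associates.mk (h • a))
  rw [Associates.prime_mk]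
  exact (MulEquiv.prime_iff (MulSemiringAction.toRingEquiv H R h)).2 hPp

open UniqueFactorizationMonoid in
/-- An invariant multiplicative function extending the `p`-th power map on constants. -/
theorem exists_invariant_multiplicative [IsDomain R] [UniqueFactorizationMonoid R] {p : ℕ}
    (hexp : ∀ h : H, h ^ p = 1)
    (hk : ∀ (h : H) (c : k), h • algebraMap k R c = algebraMap k R c)
    (hU : ∀ u : Rˣ, ∃ c : k, algebraMap k R c = u) :
    ∃ Φ : R → k, (∀ a, a ≠ 0 → Φ a ≠ 0) ∧ (∀ a b, a ≠ 0 → b ≠ 0 → Φ (a * b) = Φ a * Φ b) ∧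
      (∀ (h : H) a, a ≠ 0 → Φ (h • a) = Φ a) ∧
      ∀ c : k, c ≠ 0 → Φ (algebraMap k R c) = c ^ p := by
  classical
  obtain ⟨n, hn, hnH⟩ := exists_representatives hexp hk hU
  set N : Multiset (Associates R) → R := fun s => (s.map n).prod with hN
  have hNmk : ∀ s, Associates.mk (N s) = s.prod := by
    intro s
    induction s using Multiset.induction_on with
    | empty => simp [hN]
    | cons D s ih =>
      have : N (D ::ₘ s) = n D * N s := by simp [hN]
      rw [this, ← Associates.mk_mul_mk, ih, hn, Multiset.prod_cons]
  have hNH : ∀ (h : H) (s : Multiset (Associates R)), (∀ D ∈ s, D ≠ 0) →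
      ∃ c : k, c ^ p = 1 ∧ h • N s = algebraMap k R c * N (s.map (h • ·)) := by
    intro h s
    induction s using Multiset.induction_on with
    | empty => intro _; exact ⟨1, one_pow _, by simp [hN]⟩
    | cons D s ih =>
      intro hs
      obtain ⟨c, hc, e⟩ := ih fun E hE => hs E (Multiset.mem_cons_of_mem hE)
      obtain ⟨d, hd, e'⟩ := hnH h D (hs D (Multiset.mem_cons_self D s))
      refine ⟨d * c, by rw [mul_pow, hd, hc, one_mul], ?_⟩
      have h1 : N (D ::ₘ s) = n D * N s := by simp [hN]
      have h2 : N ((D ::ₘ s).map (h • ·)) = n (h • D) * N (s.map (h • ·)) := by simp [hN]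
      rw [h1, h2, smul_mul', e, e', map_mul]
      ring
  set ν : R → R := fun a => N (normalizedFactors (Associates.mk a)) with hν
  have hmk0 : ∀ {a : R}, a ≠ 0 → Associates.mk a ≠ 0 := fun ha => Associates.mk_ne_zero.2 ha
  have hνa : ∀ a, a ≠ 0 → Associates.mk (ν a) = Associates.mk a := fun a ha => by
    rw [hν, hNmk]
    exact associated_iff_eq.1 (prod_normalizedFactors (hmk0 ha))
  have hγ : ∀ a, ∃ c : k, a ≠ 0 → a = algebraMap k R c * ν a := by
    intro a
    by_cases ha : a = 0
    · exact ⟨0, fun h => absurd ha h⟩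
    · obtain ⟨u, hu⟩ := Associates.mk_eq_mk_iff_associated.1 (hνa a ha)
      obtain ⟨c, hc⟩ := hU u
      exact ⟨c, fun _ => by rw [hc, mul_comm, hu]⟩
  choose γ hγ using hγ
  have hinj := FaithfulSMul.algebraMap_injective k R
  have hν0 : ∀ a, a ≠ 0 → ν a ≠ 0 := fun a ha h0 => by
    have := hγ a ha
    rw [h0, mul_zero] at this
    exact ha this
  have huniq : ∀ a c, a ≠ 0 → a = algebraMap k R c * ν a → γ a = c := fun a c ha e =>
    hinj (mul_right_cancel₀ (hν0 a ha) ((hγ a ha).symm.trans e))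
  refine ⟨fun a => γ a ^ p, fun a ha => pow_ne_zero _ fun h0 => ?_, fun a b ha hb => ?_,
    fun h a ha => ?_, fun c hc => ?_⟩
  · have := hγ a ha
    rw [h0, map_zero, zero_mul] at this
    exact ha this
  · change γ (a * b) ^ p = γ a ^ p * γ b ^ p
    rw [← mul_pow, huniq (a * b) (γ a * γ b) (mul_ne_zero ha hb)]
    have : ν (a * b) = ν a * ν b := by
      simp only [hν, hN]
      rw [← Associates.mk_mul_mk, normalizedFactors_mul (hmk0 ha) (hmk0 hb), Multiset.map_add,
        Multiset.prod_add]
    rw [this, map_mul]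
    conv_lhs => rw [hγ a ha, hγ b hb]
    ring
  · change γ (h • a) ^ p = γ a ^ p
    have ha' : h • a ≠ 0 := (smul_ne_zero_iff_ne h).2 ha
    obtain ⟨c, hc, e⟩ := hNH h (normalizedFactors (Associates.mk a))
      fun D hD => (prime_of_normalized_factor D hD).ne_zero
    rw [← associates_normalizedFactors_smul h (hmk0 ha)] at e
    rw [huniq (h • a) (γ a * c) ha', mul_pow, hc, mul_one]
    have e' : h • ν a = algebraMap k R c * ν (h • a) := by
      simpa only [associates_smul_mk] using e
    rw [map_mul, mul_assoc, ← e', ← hk h, ← smul_mul', ← hγ a ha]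
  · have hc' : algebraMap k R c ≠ 0 := fun h => hc (hinj (h.trans (map_zero _).symm))
    have hu : IsUnit (algebraMap k R c) := (isUnit_iff_ne_zero.2 hc).map _
    have : ν (algebraMap k R c) = 1 := by
      simp only [hν, hN]
      rw [Associates.mk_eq_one.2 hu, normalizedFactors_one]; simp
    change γ _ ^ p = _
    rw [huniq _ c hc' (by rw [this, mul_one])]

/-- The fraction field version of `exists_invariant_multiplicative`, applied to a relation saying
that a constant is trivial in the coinvariants of the multiplicative group. -/
theorem pow_eq_one_of_coinvariants [IsDomain R] [UniqueFactorizationMonoid R] {p : ℕ}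
    (hexp : ∀ h : H, h ^ p = 1)
    (hk : ∀ (h : H) (c : k), h • algebraMap k R c = algebraMap k R c)
    (hU : ∀ u : Rˣ, ∃ c : k, algebraMap k R c = u)
    {M : Type*} [Field M] [Algebra R M] [IsFractionRing R M] [MulSemiringAction H M]
    [SMulDistribClass H R M] {s t : H} {f g : M} (hf : f ≠ 0) (hg : g ≠ 0) {c : k} (hc : c ≠ 0)
    (e : (t • f) * g = algebraMap R M (algebraMap k R c) * (f * (s • g))) : c ^ p = 1 := by
  obtain ⟨Φ, h0, hmul, hinv, hconst⟩ := exists_invariant_multiplicative hexp hk hU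
  obtain ⟨a, b, hb, rfl⟩ := IsFractionRing.div_surjective R f
  obtain ⟨x, y, hy, rfl⟩ := IsFractionRing.div_surjective R g
  have hb := nonZeroDivisors.ne_zero hb
  have hy := nonZeroDivisors.ne_zero hy
  have hinj := IsFractionRing.injective R M
  have ha : a ≠ 0 := by rintro rfl; simp at hf
  have hx : x ≠ 0 := by rintro rfl; simp at hg
  have hS : ∀ (h : H) (r : R), h • algebraMap R M r = algebraMap R M (h • r) :=
    fun h r => (algebraMap.coe_smul' h r M).symm
  have hS0 : ∀ (h : H) {r : R}, r ≠ 0 → h • r ≠ 0 := fun h r hr => (smul_ne_zero_iff_ne h).2 hr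
  have hS1 : ∀ {r : R}, r ≠ 0 → algebraMap R M r ≠ 0 := fun hr h =>
    hr (hinj (h.trans (map_zero _).symm))
  have hc' : algebraMap k R c ≠ 0 := fun h =>
    hc (FaithfulSMul.algebraMap_injective k R (h.trans (map_zero _).symm))
  simp only [smul_div₀', hS] at e
  have e1 : (t • a * x) * (b * s • y) = algebraMap k R c * ((a * s • x) * (t • b * y)) := by
    apply hinj
    have := hS1 hb; have := hS1 hy; have := hS1 (hS0 t hb); have := hS1 (hS0 s hy)
    simp only [map_mul]
    field_simp at e
    linear_combination e
  have e2 := congrArg Φ e1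
  have hta := hS0 t ha
  have htb := hS0 t hb
  have hsx := hS0 s hx
  have hsy := hS0 s hy
  rw [hmul _ _ (mul_ne_zero hta hx) (mul_ne_zero hb hsy), hmul _ _ hta hx, hmul _ _ hb hsy,
    hmul _ _ hc' (mul_ne_zero (mul_ne_zero ha hsx) (mul_ne_zero htb hy)),
    hmul _ _ (mul_ne_zero ha hsx) (mul_ne_zero htb hy), hmul _ _ ha hsx, hmul _ _ htb hy,
    hinv t a ha, hinv t b hb, hinv s x hx, hinv s y hy, hconst c hc] at e2
  apply mul_right_cancel₀ (mul_ne_zero (mul_ne_zero (h0 a ha) (h0 x hx))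
    (mul_ne_zero (h0 b hb) (h0 y hy)))
  linear_combination -e2

end InvariantNormalization

section Kummer

variable {F Ω : Type*} [Field F] [Field Ω] [Algebra F Ω] [IsGalois F Ω]

/-- Hilbert 90 for a character of a subgroup of the Galois group with invariant values and open
kernel. -/
theorem exists_semiinvariant (N : Subgroup (Ω ≃ₐ[F] Ω)) (hN : IsOpen (N : Set (Ω ≃ₐ[F] Ω)))
    (S : Subgroup (Ω ≃ₐ[F] Ω)) (χ : S →* Ω) (hfix : ∀ (g : Ω ≃ₐ[F] Ω) (s : S), g (χ s) = χ s)
    (htriv : ∀ s : S, (s : Ω ≃ₐ[F] Ω) ∈ N → χ s = 1) :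
    ∃ C : Ω, C ≠ 0 ∧ ∀ s : S, (s : Ω ≃ₐ[F] Ω) C = χ s * C := by
  classical
  set K := IntermediateField.fixedField N with hK
  have hNK : K.fixingSubgroup = N :=
    InfiniteGalois.fixingSubgroup_fixedField ⟨N, Subgroup.isClosed_of_isOpen N hN⟩
  have hfin : FiniteDimensional F K := by
    rw [← InfiniteGalois.isOpen_iff_finite, hNK]; exact hN
  let r : S → (K →ₐ[F] Ω) := fun s => (s : Ω ≃ₐ[F] Ω).toAlgHom.comp K.val
  have hr : ∀ s t : S, r s = r t → χ s = χ t := by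
    intro s t hst
    have h1 : ((t⁻¹ * s : S) : Ω ≃ₐ[F] Ω) ∈ N := by
      rw [← hNK, IntermediateField.mem_fixingSubgroup_iff]
      intro x hx
      have h2 : (s : Ω ≃ₐ[F] Ω) x = (t : Ω ≃ₐ[F] Ω) x := DFunLike.congr_fun hst ⟨x, hx⟩
      change (t : Ω ≃ₐ[F] Ω)⁻¹ ((s : Ω ≃ₐ[F] Ω) x) = x
      rw [h2]
      exact (t : Ω ≃ₐ[F] Ω).symm_apply_apply x
    have h3 := htriv _ h1
    calc χ s = χ (t * (t⁻¹ * s)) := by rw [mul_inv_cancel_left]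
      _ = χ t := by rw [map_mul, h3, mul_one]
  have : Finite (Set.range r) := inferInstance
  let : Fintype (Set.range r) := Fintype.ofFinite _
  let c : Set.range r → S := fun φ => φ.2.choose
  have hc : ∀ φ : Set.range r, r (c φ) = φ := fun φ => φ.2.choose_spec
  have hli : LinearIndependent Ω (fun φ : Set.range r => ((φ : K →ₐ[F] Ω) : K → Ω)) := by
    refine (linearIndependent_monoidHom K Ω).comp
      (fun φ : Set.range r => ((φ : K →ₐ[F] Ω) : K →* Ω)) ?_
    intro φ φ' h
    apply Subtype.ext
    ext x
    exact DFunLike.congr_fun h x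
  have hne : ∑ φ : Set.range r, χ (c φ)⁻¹ • ((φ : K →ₐ[F] Ω) : K → Ω) ≠ 0 := by
    intro h0
    have h1 := Fintype.linearIndependent_iff.1 hli _ h0 ⟨r 1, 1, rfl⟩
    have h2 : χ (c ⟨r 1, 1, rfl⟩)⁻¹ * χ (c ⟨r 1, 1, rfl⟩) = 1 := by
      rw [← map_mul, inv_mul_cancel, map_one]
    rw [h1, zero_mul] at h2
    exact zero_ne_one h2
  obtain ⟨x, hx⟩ := Function.ne_iff.1 hne
  refine ⟨∑ φ : Set.range r, χ (c φ)⁻¹ * (φ : K →ₐ[F] Ω) x, ?_, fun t => ?_⟩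
  · simpa [Finset.sum_apply] using hx
  · let m : S → Set.range r → Set.range r := fun t φ => ⟨r (t * c φ), t * c φ, rfl⟩
    have hrm : ∀ (u : S) (φ : Set.range r) (y : K),
        r (u * c φ) y = (u : Ω ≃ₐ[F] Ω) ((φ : K →ₐ[F] Ω) y) := by
      intro u φ y
      conv_rhs => rw [← hc φ]
      rfl
    have hcoe : ∀ u φ, ((m u φ : Set.range r) : K →ₐ[F] Ω) = r (u * c φ) := fun _ _ => rfl
    let e : Set.range r ≃ Set.range r :=
      { toFun := m t
        invFun := m t⁻¹
        left_inv := fun φ => by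
          apply Subtype.ext; ext y
          rw [hcoe, hrm, hcoe, hrm]
          exact (t : Ω ≃ₐ[F] Ω).symm_apply_apply _
        right_inv := fun φ => by
          apply Subtype.ext; ext y
          rw [hcoe, hrm, hcoe, hrm]
          exact (t : Ω ≃ₐ[F] Ω).apply_symm_apply _ }
    rw [map_sum, Finset.mul_sum]
    refine Fintype.sum_equiv e _ _ fun φ => ?_
    have h1 : χ (c (e φ)) = χ (t * c φ) := hr _ _ (hc (e φ))
    have h2 : χ (c (e φ))⁻¹ = χ (t * c φ)⁻¹ := by
      have e1 : χ (c (e φ))⁻¹ * χ (c (e φ)) = 1 := by rw [← map_mul, inv_mul_cancel, map_one]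
      have e2 : χ (t * c φ)⁻¹ * χ (t * c φ) = 1 := by rw [← map_mul, inv_mul_cancel, map_one]
      rw [h1] at e1
      have : χ (t * c φ) ≠ 0 := fun h => by rw [h, mul_zero] at e2; exact zero_ne_one e2
      exact mul_right_cancel₀ this (e1.trans e2.symm)
    have h3 : ((e φ : Set.range r) : K →ₐ[F] Ω) x = (t : Ω ≃ₐ[F] Ω) ((φ : K →ₐ[F] Ω) x) :=
      hrm t φ x
    have h4 : χ t * χ t⁻¹ = 1 := by rw [← map_mul, mul_inv_cancel, map_one]
    rw [map_mul, hfix, h2, h3, mul_inv_rev, map_mul]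
    linear_combination (-χ (c φ)⁻¹ * (t : Ω ≃ₐ[F] Ω) ((φ : K →ₐ[F] Ω) x)) * h4


end Kummer

section Heisenberg

variable {F Ω : Type*} [Field F] [Field Ω] [Algebra F Ω] [IsGalois F Ω]

/-- The coordinates of a homomorphism to a Heisenberg group over a ring `R` with an ideal `I` of
square zero express the value of a character at an element congruent to `1` as a product of
coboundaries of elements fixed by the preimage of the centre modulo `I`. -/
theorem exists_coboundary_relation {R : Type*} [CommRing R] {I : Ideal R}
    (hI : ∀ x ∈ I, ∀ y ∈ I, x * y = 0) {a b z : (Ω ≃ₐ[F] Ω) → R}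
    (ha : ∀ g h, a (g * h) = a g + a h) (hb : ∀ g h, b (g * h) = b g + b h)
    (hz : ∀ g h, z (g * h) = z h + a g * b h + z g)
    {N : Subgroup (Ω ≃ₐ[F] Ω)} (hN : IsOpen (N : Set (Ω ≃ₐ[F] Ω)))
    (haN : ∀ g ∈ N, a g = 0) (hbN : ∀ g ∈ N, b g = 0) (hzN : ∀ g ∈ N, z g = 0)
    (ψ : AddChar R Ω) (hψ : ∀ (g : Ω ≃ₐ[F] Ω) x, g (ψ x) = ψ x)
    {s t : Ω ≃ₐ[F] Ω} (has : a s - 1 ∈ I) (hbs : b s ∈ I) (hat : a t ∈ I) (hbt : b t - 1 ∈ I) :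
    ∃ f g : Ω, f ≠ 0 ∧ g ≠ 0 ∧ (∀ h, a h ∈ I → b h ∈ I → h f = f) ∧
      (∀ h, a h ∈ I → b h ∈ I → h g = g) ∧
      t f * g = ψ (a s + b t - a s * b t) * (f * s g) := by
  have ha1 : a 1 = 0 := by simpa using ha 1 1
  have hb1 : b 1 = 0 := by simpa using hb 1 1
  have hz1 : z 1 = 0 := by simpa [ha1] using hz 1 1
  have hai : ∀ g, a g⁻¹ = -a g := fun g => by
    have := ha g g⁻¹
    rw [mul_inv_cancel, ha1] at this
    linear_combination -this
  have hbi : ∀ g, b g⁻¹ = -b g := fun g => by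
    have := hb g g⁻¹
    rw [mul_inv_cancel, hb1] at this
    linear_combination -this
  let S : Subgroup (Ω ≃ₐ[F] Ω) :=
    { carrier := {h | a h ∈ I ∧ b h ∈ I}
      one_mem' := by simp [ha1, hb1]
      mul_mem' := fun {g h} hg hh => by
        simp only [Set.mem_ofPred_eq, ha, hb]
        exact ⟨I.add_mem hg.1 hh.1, I.add_mem hg.2 hh.2⟩
      inv_mem' := fun {g} hg => by
        simp only [Set.mem_ofPred_eq, hai, hbi]
        exact ⟨I.neg_mem hg.1, I.neg_mem hg.2⟩ }
  obtain ⟨A, hA0, hA⟩ := exists_semiinvariant N hN ⊤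
    { toFun := fun g => ψ (a g)
      map_one' := by simp [ha1]
      map_mul' := fun g h => by simp [ha, AddChar.map_add_eq_mul] }
    (fun g s => hψ g _) (fun s hs => by simp [haN _ hs])
  obtain ⟨B, hB0, hB⟩ := exists_semiinvariant N hN ⊤
    { toFun := fun g => ψ (b g)
      map_one' := by simp [hb1]
      map_mul' := fun g h => by simp [hb, AddChar.map_add_eq_mul] }
    (fun g s => hψ g _) (fun s hs => by simp [hbN _ hs])
  obtain ⟨C, hC0, hC⟩ := exists_semiinvariant N hN S
    { toFun := fun g => ψ (z g)
      map_one' := by simp [hz1]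
      map_mul' := fun g h => by
        simp [hz, AddChar.map_add_eq_mul, hI _ g.2.1 _ h.2.2, mul_comm] }
    (fun g s => hψ g _) (fun s hs => by simp [hzN _ hs])
  replace hA : ∀ g : Ω ≃ₐ[F] Ω, g A = ψ (a g) * A := fun g => hA ⟨g, trivial⟩
  replace hB : ∀ g : Ω ≃ₐ[F] Ω, g B = ψ (b g) * B := fun g => hB ⟨g, trivial⟩
  replace hC : ∀ g : Ω ≃ₐ[F] Ω, a g ∈ I → b g ∈ I → g C = ψ (z g) * C :=
    fun g h1 h2 => hC ⟨g, h1, h2⟩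
  have hconj : ∀ g h : Ω ≃ₐ[F] Ω, a h ∈ I → b h ∈ I →
      h (g C) = ψ (z h + a h * b g - a g * b h) * g C := by
    intro g h h1 h2
    have e : h * g = g * (g⁻¹ * h * g) := by group
    have ea : a (g⁻¹ * h * g) = a h := by rw [ha, ha, hai]; ring
    have eb : b (g⁻¹ * h * g) = b h := by rw [hb, hb, hbi]; ring
    have ez : z (g⁻¹ * h * g) = z h + a h * b g - a g * b h := by
      have e' := congrArg z e
      rw [hz h g, hz g, eb] at e'
      linear_combination -e'
    calc h (g C) = (h * g) C := rfl
      _ = g ((g⁻¹ * h * g) C) := by rw [e]; rfl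
      _ = _ := by rw [hC _ (ea ▸ h1) (eb ▸ h2), map_mul, hψ, ez]
  have hsC : s C ≠ 0 := by simpa using hC0
  have htC : t C ≠ 0 := by simpa using hC0
  have hψ0 : ∀ x, ψ x ≠ 0 := fun x h => by
    have := ψ.map_add_eq_mul x (-x)
    rw [add_neg_cancel, AddChar.map_zero_eq_one, h, zero_mul] at this
    exact one_ne_zero this
  refine ⟨s C * B / C, t C / (A * C), div_ne_zero (mul_ne_zero hsC hB0) hC0,
    div_ne_zero htC (mul_ne_zero hA0 hC0), fun h h1 h2 => ?_, fun h h1 h2 => ?_, ?_⟩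
  · have e : z h + a h * b s - a s * b h + b h = z h := by
      linear_combination hI _ h1 _ hbs - hI _ has _ h2
    rw [map_div₀, map_mul, hconj s h h1 h2, hB, hC h h1 h2]
    have := hψ0 (z h)
    rw [div_eq_div_iff (mul_ne_zero this hC0) hC0]
    have e2 : ψ (z h + a h * b s - a s * b h) * ψ (b h) = ψ (z h) := by
      rw [← AddChar.map_add_eq_mul, e]
    linear_combination (s C * B * C) * e2
  · have e : z h + a h * b t - a t * b h = a h + z h := by
      linear_combination hI _ h1 _ hbt - hI _ hat _ h2
    rw [map_div₀, map_mul, hconj t h h1 h2, hA, hC h h1 h2, e, AddChar.map_add_eq_mul]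
    have := hψ0 (z h)
    have := hψ0 (a h)
    field_simp
  · set κ := t⁻¹ * s⁻¹ * t * s with hκ
    have e : t * s = s * t * κ := by rw [hκ]; group
    have ea : a κ = 0 := by simp only [hκ, ha, hai]; ring
    have eb : b κ = 0 := by simp only [hκ, hb, hbi]; ring
    have ez : z κ = - (a s * b t) := by
      have e' := congrArg z e
      rw [hz t s, hz (s * t), hz s t, eb] at e'
      linear_combination -e' + hI _ hat _ hbs
    have hts : t (s C) = ψ (-(a s * b t)) * s (t C) := by
      calc t (s C) = (t * s) C := rfl
        _ = s (t (κ C)) := by rw [e]; rfl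
        _ = _ := by
          rw [hC κ (by simp [ea]) (by simp [eb]), map_mul, map_mul, hψ, hψ, ez]
    have hstC : s (t C) ≠ 0 := by simpa using hC0
    rw [map_div₀, map_mul, map_div₀, map_mul, hts, hA, hB, sub_eq_add_neg,
      AddChar.map_add_eq_mul, AddChar.map_add_eq_mul]
    have := hψ0 (a s)
    field_simp

end Heisenberg

section PermutationField

/-- A finite group of exponent dividing `p` acts faithfully on a rational function field over `ℂ`
in such a way that only `p`-th roots of unity die in the coinvariants of the multiplicative
group. -/
theorem exists_faithful_action (H : Type) [Group H] {p : ℕ} (hexp : ∀ h : H, h ^ p = 1) :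
    ∃ (M : Type) (_ : Field M) (_ : Algebra ℂ M) (_ : MulSemiringAction H M),
      FaithfulSMul H M ∧ (∀ (h : H) (c : ℂ), h • algebraMap ℂ M c = algebraMap ℂ M c) ∧
      ∀ (s t : H) (f g : M) (c : ℂ), f ≠ 0 → g ≠ 0 → c ≠ 0 →
        (t • f) * g = algebraMap ℂ M c * (f * (s • g)) → c ^ p = 1 := by
  let act : MulSemiringAction H (MvPolynomial H ℂ) :=
    { smul := fun h f => MvPolynomial.rename (h * ·) f
      one_smul := fun f => by
        change MvPolynomial.rename (1 * ·) f = f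
        simp only [one_mul]
        exact MvPolynomial.rename_id_apply f
      mul_smul := fun g h f => by
        change MvPolynomial.rename _ f = MvPolynomial.rename _ (MvPolynomial.rename _ f)
        rw [MvPolynomial.rename_rename]
        congr 2
        funext x
        exact mul_assoc g h x
      smul_zero := fun h => map_zero (MvPolynomial.rename (h * ·))
      smul_one := fun h => map_one (MvPolynomial.rename (h * ·))
      smul_add := fun h => map_add (MvPolynomial.rename (h * ·))
      smul_mul := fun h => map_mul (MvPolynomial.rename (h * ·)) }
  have hsmul : ∀ (h : H) (f : MvPolynomial H ℂ), h • f = MvPolynomial.rename (h * ·) f :=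
    fun _ _ => rfl
  have hk : ∀ (h : H) (c : ℂ), h • algebraMap ℂ (MvPolynomial H ℂ) c = algebraMap ℂ _ c :=
    fun h c => by rw [hsmul, AlgHom.commutes]
  have hU : ∀ u : (MvPolynomial H ℂ)ˣ, ∃ c : ℂ, algebraMap ℂ (MvPolynomial H ℂ) c = u := by
    intro u
    obtain ⟨r, -, hr⟩ := MvPolynomial.isUnit_iff_eq_C_of_isReduced.1 u.isUnit
    exact ⟨r, hr.symm⟩
  let M := FractionRing (MvPolynomial H ℂ)
  let actM : MulSemiringAction H M := IsFractionRing.mulSemiringAction H (MvPolynomial H ℂ) M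
  have hdist : SMulDistribClass H (MvPolynomial H ℂ) M :=
    IsFractionRing.smulDistribClass H (MvPolynomial H ℂ) M
  have hfaith : FaithfulSMul H (MvPolynomial H ℂ) := ⟨fun {g h} e => by
    have := e (MvPolynomial.X 1)
    simpa [hsmul] using this⟩
  refine ⟨M, inferInstance, inferInstance, actM,
    IsFractionRing.faithfulSMul H (MvPolynomial H ℂ) M, fun h c => ?_,
    fun s t f g c hf hg hc e => ?_⟩
  · rw [IsScalarTower.algebraMap_apply ℂ (MvPolynomial H ℂ) M,
      ← algebraMap.coe_smul' h _ M, hk]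
  · exact pow_eq_one_of_coinvariants (R := MvPolynomial H ℂ) hexp hk hU hf hg hc
      (by rw [e, IsScalarTower.algebraMap_apply ℂ (MvPolynomial H ℂ) M])

end PermutationField

section Unitriangular

variable {R : Type} [CommRing R]

/-- The unitriangular matrix with entries `x`, `y` above the diagonal and `z` in the corner. -/
def heisenberg (x y z : R) : GL (Fin 3) R where
  val := !![1, x, z; 0, 1, y; 0, 0, 1]
  inv := !![1, -x, x * y - z; 0, 1, -y; 0, 0, 1]
  val_inv := by
    ext i j
    fin_cases i <;> fin_cases j <;> simp [Matrix.mul_apply, Fin.sum_univ_three]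
    ring
  inv_val := by
    ext i j
    fin_cases i <;> fin_cases j <;> simp [Matrix.mul_apply, Fin.sum_univ_three]
    ring

theorem heisenberg_inv (x y z : R) : (heisenberg x y z)⁻¹ = heisenberg (-x) (-y) (x * y - z) := by
  ext i j
  fin_cases i <;> fin_cases j <;> simp [heisenberg]

theorem heisenberg_mul (x y z x' y' z' : R) :
    heisenberg x y z * heisenberg x' y' z' = heisenberg (x + x') (y + y') (z' + x * y' + z) := by
  ext i j
  fin_cases i <;> fin_cases j <;>
    simp [heisenberg, Matrix.mul_apply, Fin.sum_univ_three, add_comm]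

theorem heisenberg_zero : heisenberg (0 : R) 0 0 = 1 := by
  ext i j
  fin_cases i <;> fin_cases j <;> simp [heisenberg]

theorem heisenberg_pow (x y z : R) (n : ℕ) :
    heisenberg x y z ^ n = heisenberg (n * x) (n * y) (n * z + n.choose 2 * (x * y)) := by
  induction n with
  | zero => simp [heisenberg_zero]
  | succ n ih =>
    have : (n + 1).choose 2 = n + n.choose 2 := by
      rw [Nat.choose_succ_succ' n 1, Nat.choose_one_right]
    rw [pow_succ, ih, heisenberg_mul, this]
    push_cast
    congr 1 <;> ring

theorem isUniTri_heisenberg (x y z : R) : IsUniTri (heisenberg x y z) := by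
  refine ⟨fun i j hij => ?_, fun i => ?_⟩
  · fin_cases i <;> fin_cases j <;> simp [heisenberg] at hij ⊢
  · fin_cases i <;> simp [heisenberg]

theorem IsUniTri.eq_heisenberg {g : GL (Fin 3) R} (hg : IsUniTri g) :
    g = heisenberg (g 0 1) (g 1 2) (g 0 2) := by
  have h0 := hg.1 1 0 (by decide)
  have h1 := hg.1 2 0 (by decide)
  have h2 := hg.1 2 1 (by decide)
  have := hg.2
  ext i j
  fin_cases i <;> fin_cases j <;> simp_all [heisenberg]

/-- The group of unitriangular matrices of size three. -/
def uniTriSubgroup (R : Type) [CommRing R] : Subgroup (GL (Fin 3) R) where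
  carrier := {g | IsUniTri g}
  one_mem' := by
    rw [Set.mem_ofPred_eq, ← heisenberg_zero]
    exact isUniTri_heisenberg _ _ _
  mul_mem' := fun {g h} hg hh => by
    rw [Set.mem_ofPred_eq, hg.eq_heisenberg, hh.eq_heisenberg, heisenberg_mul]
    exact isUniTri_heisenberg _ _ _
  inv_mem' := fun {g} hg => by
    rw [Set.mem_ofPred_eq, hg.eq_heisenberg, heisenberg_inv]
    exact isUniTri_heisenberg _ _ _

theorem uniTriSubgroup_pow_eq_one {p : ℕ} [Fact p.Prime] (hodd : p ≠ 2)
    (h : uniTriSubgroup (ZMod p)) : h ^ p = 1 := by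
  have hp : p.Prime := Fact.out
  have h2 : ((p.choose 2 : ℕ) : ZMod p) = 0 := by
    rw [ZMod.natCast_eq_zero_iff]
    exact hp.dvd_choose_self two_ne_zero (lt_of_le_of_ne hp.two_le hodd.symm)
  apply Subtype.ext
  rw [Subgroup.coe_pow, IsUniTri.eq_heisenberg h.2, heisenberg_pow, h2]
  simp [heisenberg_zero]

end Unitriangular

theorem ZMod.mul_eq_zero_of_castHom_eq_zero {p : ℕ} (x y : ZMod (p ^ 2))
    (hx : x ∈ RingHom.ker (ZMod.castHom (dvd_pow_self p two_ne_zero) (ZMod p)))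
    (hy : y ∈ RingHom.ker (ZMod.castHom (dvd_pow_self p two_ne_zero) (ZMod p))) : x * y = 0 := by
  obtain ⟨m, rfl⟩ := ZMod.intCast_surjective x
  obtain ⟨n, rfl⟩ := ZMod.intCast_surjective y
  rw [RingHom.mem_ker, map_intCast, ZMod.intCast_zmod_eq_zero_iff_dvd] at hx hy
  rw [← Int.cast_mul, ZMod.intCast_zmod_eq_zero_iff_dvd, pow_two]
  push_cast
  exact mul_dvd_mul hx hy

/-- A finite Galois extension with group `H` realises `H` as a quotient of the absolute Galois
group. -/
theorem exists_embedding_restriction {F M H : Type} [Field F] [Field M] [Algebra F M]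
    [IsGalois F M] [Group H] (e : H ≃* (M ≃ₐ[F] M)) :
    ∃ (j : M →ₐ[F] SeparableClosure F) (π : AbsGal F →* H), Function.Surjective π ∧
      ∀ g m, g (j m) = j (e (π g) m) := by
  let j : M →ₐ[F] SeparableClosure F := IsSepClosed.lift
  let : Algebra M (SeparableClosure F) := j.toAlgebra
  have : IsScalarTower F M (SeparableClosure F) :=
    IsScalarTower.of_algebraMap_eq fun x => (j.commutes x).symm
  refine ⟨j, e.symm.toMonoidHom.comp (AlgEquiv.restrictNormalHom M),
    e.symm.surjective.comp (AlgEquiv.restrictNormalHom_surjective (SeparableClosure F)),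
    fun g m => ?_⟩
  have h1 : e (e.symm (AlgEquiv.restrictNormalHom M g)) = AlgEquiv.restrictNormalHom M g :=
    e.apply_symm_apply _
  refine Eq.trans ?_ (congrArg j (DFunLike.congr_fun h1 m)).symm
  exact (g.restrictNormal_commutes M m).symm

set_option maxHeartbeats 800000 in
theorem stmt_8 (p : ℕ) [Fact p.Prime] (hodd : p ≠ 2) :
    ∃ (F : Type) (_ : Field F) (_ : Algebra ℂ F),
      ∃ ρ : AbsGal F →* GL (Fin 3) (ZMod p),
        IsOpen (ρ.ker : Set (AbsGal F)) ∧ (∀ g, IsUniTri (ρ g)) ∧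
        ¬ ∃ ρ₂ : AbsGal F →* GL (Fin 3) (ZMod (p ^ 2)),
            IsOpen (ρ₂.ker : Set (AbsGal F)) ∧ (∀ g, IsUniTri (ρ₂ g)) ∧
            (Matrix.GeneralLinearGroup.map
              (ZMod.castHom (dvd_pow_self p two_ne_zero) (ZMod p))).comp ρ₂ = ρ := by
  have hp : p.Prime := Fact.out
  let H := uniTriSubgroup (ZMod p)
  obtain ⟨M, _, _, _, _, hk, hM⟩ :=
    exists_faithful_action H (p := p) (uniTriSubgroup_pow_eq_one hodd)
  let F := FixedPoints.subfield H M
  let i : ℂ →+* F := (algebraMap ℂ M).codRestrict F fun c h => hk h c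
  obtain ⟨j, π, hπsurj, hπ'⟩ := exists_embedding_restriction (FixedPoints.toAlgAutMulEquiv H M)
  have hπ : ∀ (g : AbsGal F) (m : M), g (j m) = j (π g • m) := hπ'
  have hker : (H.subtype.comp π).ker = j.fieldRange.fixingSubgroup := by
    ext g
    rw [IntermediateField.mem_fixingSubgroup_iff, MonoidHom.mem_ker]
    constructor
    · rintro hg _ ⟨m, rfl⟩
      have : π g = 1 := Subtype.ext hg
      change g (j m) = j m
      rw [hπ, this, one_smul]
    · intro hg
      have : π g = 1 := by
        apply FaithfulSMul.eq_of_smul_eq_smul (α := M)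
        intro m
        rw [one_smul]
        exact j.injective ((hπ g m).symm.trans (hg _ ⟨m, rfl⟩))
      exact congrArg Subtype.val this
  have hfin : FiniteDimensional F j.fieldRange :=
    LinearEquiv.finiteDimensional (AlgEquiv.ofInjectiveField j).toLinearEquiv
  refine ⟨F, inferInstance, i.toAlgebra, H.subtype.comp π, ?_, fun g => (π g).2, ?_⟩
  · rw [hker]
    exact (InfiniteGalois.isOpen_iff_finite _).2 hfin
  rintro ⟨ρ₂, hopen, huni, hlift⟩
  have hmul := fun g h => by
    have := map_mul ρ₂ g h
    rw [(huni g).eq_heisenberg, (huni h).eq_heisenberg, heisenberg_mul] at this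
    exact this
  have hred : ∀ g k l, ZMod.castHom (dvd_pow_self p two_ne_zero) (ZMod p) (ρ₂ g k l) =
      (π g : GL (Fin 3) (ZMod p)) k l := fun g k l => by
    have := DFunLike.congr_fun hlift g
    exact congrArg (fun m : GL (Fin 3) (ZMod p) => m k l) this
  obtain ⟨s, hs⟩ := hπsurj ⟨heisenberg 1 0 0, isUniTri_heisenberg _ _ _⟩
  obtain ⟨t, ht⟩ := hπsurj ⟨heisenberg 0 1 0, isUniTri_heisenberg _ _ _⟩
  set c := ZMod.castHom (dvd_pow_self p two_ne_zero) (ZMod p) with hc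
  have has : c (ρ₂ s 0 1) = 1 := by rw [hred, hs]; simp [heisenberg]
  have hbs : c (ρ₂ s 1 2) = 0 := by rw [hred, hs]; simp [heisenberg]
  have hat : c (ρ₂ t 0 1) = 0 := by rw [hred, ht]; simp [heisenberg]
  have hbt : c (ρ₂ t 1 2) = 1 := by rw [hred, ht]; simp [heisenberg]
  have : NeZero (p ^ 2) := ⟨pow_ne_zero 2 hp.ne_zero⟩
  let ι : ℂ →+* SeparableClosure F := (algebraMap F (SeparableClosure F)).comp i
  let ψ : AddChar (ZMod (p ^ 2)) (SeparableClosure F) :=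
    ι.toMonoidHom.compAddChar (ZMod.stdAddChar (N := p ^ 2))
  have hιj : ∀ x, ι x = j (algebraMap ℂ M x) := fun x => (j.commutes (i x)).symm
  obtain ⟨f, g, hf0, hg0, hf, hg, e⟩ := exists_coboundary_relation
    (I := RingHom.ker c) (fun x hx y hy => ZMod.mul_eq_zero_of_castHom_eq_zero x y hx hy)
    (a := fun g => ρ₂ g 0 1) (b := fun g => ρ₂ g 1 2) (z := fun g => ρ₂ g 0 2)
    (fun g h => by simp [hmul, heisenberg]) (fun g h => by simp [hmul, heisenberg])
    (fun g h => by simp [hmul, heisenberg]) hopen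
    (fun g hg => by simp [MonoidHom.mem_ker.1 hg]) (fun g hg => by simp [MonoidHom.mem_ker.1 hg])
    (fun g hg => by simp [MonoidHom.mem_ker.1 hg]) ψ
    (fun g x => g.commutes _) (s := s) (t := t)
    (by simp [RingHom.mem_ker, has]) hbs hat (by simp [RingHom.mem_ker, hbt])
  have hrange : ∀ x : SeparableClosure F, (∀ h, ρ₂ h 0 1 ∈ RingHom.ker c →
      ρ₂ h 1 2 ∈ RingHom.ker c → h x = x) → ∃ m, j m = x := by
    intro x hx
    have h1 : x ∈ j.fieldRange := by
      rw [← InfiniteGalois.fixedField_fixingSubgroup j.fieldRange, ← hker,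
        IntermediateField.mem_fixedField_iff]
      intro g hg
      have h1 : (π g : GL (Fin 3) (ZMod p)) = 1 := hg
      exact hx g (by rw [RingHom.mem_ker, hred, h1]; simp)
        (by rw [RingHom.mem_ker, hred, h1]; simp)
    exact h1
  obtain ⟨f, rfl⟩ := hrange f hf
  obtain ⟨g, rfl⟩ := hrange g hg
  set x := ρ₂ s 0 1 + ρ₂ t 1 2 - ρ₂ s 0 1 * ρ₂ t 1 2 with hx
  have e' : π t • f * g = algebraMap ℂ M (ZMod.stdAddChar x) * (f * (π s • g)) := by
    apply j.injective
    change j (π t • f * g) = j (algebraMap ℂ M (ZMod.stdAddChar x) * (f * (π s • g)))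
    rw [map_mul, map_mul, map_mul, ← hιj, ← hπ, ← hπ]
    exact e
  have h1 := hM _ _ f g _ (by rintro rfl; simp at hf0) (by rintro rfl; simp at hg0)
    (by
      intro h
      have := (ZMod.stdAddChar (N := p ^ 2)).map_add_eq_mul x (-x)
      rw [add_neg_cancel, AddChar.map_zero_eq_one, h, zero_mul] at this
      exact one_ne_zero this) e'
  rw [← AddChar.map_nsmul_eq_pow, ← AddChar.map_zero_eq_one (ZMod.stdAddChar (N := p ^ 2))] at h1
  have h2 := ZMod.injective_stdAddChar h1
  have hcx : c x = 1 := by simp [hx, has, hbt]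
  obtain ⟨n, hn⟩ := ZMod.intCast_surjective x
  rw [← hn] at h2 hcx
  rw [map_intCast] at hcx
  rw [nsmul_eq_mul, ← Int.cast_natCast, ← Int.cast_mul, ZMod.intCast_zmod_eq_zero_iff_dvd] at h2
  push_cast at h2
  rw [pow_two] at h2
  have h3 := Int.dvd_of_mul_dvd_mul_left (Int.natCast_ne_zero.2 hp.ne_zero) h2
  rw [← ZMod.intCast_zmod_eq_zero_iff_dvd, hcx] at h3
  exact one_ne_zero h3
end

section
/- Let p be an odd prime and let F be a number field containing a primitive p-th root of unity but containing no primitive p²-th root of unity. Let E = F((T)) be the field of formal Laurent series over F. Then there exists a continuous homomorphism ρ : Gal(E_s/E) → B_3(𝔽_p) that admits no lift to a continuous homomorphism Gal(E_s/E) → B_3(ℤ/p²) along the reduction ℤ/p² → ℤ/p. -/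
open scoped MatrixGroups

theorem PowerSeries.exists_pow_eq_of_constantCoeff_eq_one {K : Type*} [Field K] [CharZero K]
    {n : ℕ} (hn : n ≠ 0) (f : PowerSeries K) (hf : PowerSeries.constantCoeff f = 1) :
    ∃ u : PowerSeries K, u ^ n = f := by
  have hs : PowerSeries.HasSubst (f - 1) :=
    PowerSeries.HasSubst.of_constantCoeff_zero (by rw [map_sub, map_one]; exact sub_eq_zero.mpr hf)
  have hpow : ∀ m : ℕ, (PowerSeries.binomialSeries K (1 / (n : ℚ))) ^ m =
      PowerSeries.binomialSeries K ((m : ℚ) / n) := by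
    intro m
    induction m with
    | zero => simp
    | succ m ih =>
      rw [pow_succ, ih, ← PowerSeries.binomialSeries_add]
      congr 1
      push_cast
      ring
  have h1 : (PowerSeries.binomialSeries K (1 / (n : ℚ))) ^ n = 1 + PowerSeries.X := by
    rw [hpow, div_self (by exact_mod_cast hn)]
    simpa using PowerSeries.binomialSeries_nat (R := ℚ) (A := K) 1
  refine ⟨PowerSeries.substAlgHom hs (PowerSeries.binomialSeries K (1 / (n : ℚ))), ?_⟩
  rw [← map_pow, h1, map_add, map_one, PowerSeries.substAlgHom_X]
  ring

theorem LaurentSeries.exists_eq_C_mul_single_mul_pow {K : Type*} [Field K] [CharZero K]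
    {n : ℕ} (hn : n ≠ 0) (z : LaurentSeries K) (hz : z ≠ 0) :
    ∃ (c : K) (k : ℤ) (u : LaurentSeries K),
      c ≠ 0 ∧ z = HahnSeries.C c * HahnSeries.single 1 1 ^ k * u ^ n := by
  set c := z.leadingCoeff
  have hc : c ≠ 0 := HahnSeries.leadingCoeff_ne_zero.mpr hz
  have hcc : PowerSeries.constantCoeff z.powerSeriesPart = c := by
    rw [← PowerSeries.coeff_zero_eq_constantCoeff_apply, LaurentSeries.powerSeriesPart_coeff]
    simp [c, HahnSeries.leadingCoeff_eq]
  obtain ⟨u, hu⟩ := PowerSeries.exists_pow_eq_of_constantCoeff_eq_one hn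
    (PowerSeries.C c⁻¹ * z.powerSeriesPart) (by simp [hcc, hc])
  refine ⟨c, z.order, HahnSeries.ofPowerSeries ℤ K u, hc, ?_⟩
  conv_lhs => rw [← LaurentSeries.single_order_mul_powerSeriesPart z]
  rw [← map_pow, hu, map_mul, HahnSeries.ofPowerSeries_C]
  have : (HahnSeries.C c : LaurentSeries K) * HahnSeries.C c⁻¹ = 1 := by
    rw [← map_mul, mul_inv_cancel₀ hc, map_one]
  have h2 : (HahnSeries.single 1 1 : LaurentSeries K) ^ z.order = HahnSeries.single z.order 1 :=
    (RatFunc.single_zpow _).symm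
  rw [h2]
  linear_combination -(HahnSeries.single z.order 1 * (z.powerSeriesPart : LaurentSeries K)) * this

theorem LaurentSeries.exists_eq_C_of_pow_eq_C {K : Type*} [Field K]
    {n : ℕ} {d : K} {v : LaurentSeries K}
    (hv : v ^ n = HahnSeries.C d) : ∃ r : K, r ^ n = d := by
  refine ⟨v.leadingCoeff, ?_⟩
  have h : ∀ m : ℕ, (v ^ m).leadingCoeff = v.leadingCoeff ^ m := by
    intro m
    induction m with
    | zero => simp
    | succ m ih => rw [pow_succ, HahnSeries.leadingCoeff_mul, ih, pow_succ]
  rw [← h, hv]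
  simp [HahnSeries.C_apply]

theorem PowerSeries.expand_injective {K : Type*} [Field K] (n : ℕ) (hn : n ≠ 0) :
    Function.Injective (PowerSeries.expand n hn : PowerSeries K →ₐ[K] PowerSeries K) := by
  intro f g hfg
  ext m
  rw [← PowerSeries.coeff_expand_mul n hn f m, ← PowerSeries.coeff_expand_mul n hn g m, hfg]

/-- The ring homomorphism `F[[T]] → K((S))` with `T ↦ S ^ n`. -/
noncomputable def PowerSeries.expandMap (F K : Type*) [Field F] [Field K] [Algebra F K] (n : ℕ)
    (hn : n ≠ 0) : PowerSeries F →+* LaurentSeries K :=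
  (HahnSeries.ofPowerSeries ℤ K).comp
    ((PowerSeries.expand n hn : PowerSeries K →ₐ[K] PowerSeries K).toRingHom.comp
      (PowerSeries.map (algebraMap F K)))

theorem PowerSeries.expandMap_injective (F K : Type*) [Field F] [Field K] [Algebra F K] (n : ℕ)
    (hn : n ≠ 0) : Function.Injective (PowerSeries.expandMap F K n hn) := by
  intro f g hfg
  exact PowerSeries.map_injective _ (algebraMap F K).injective
    (PowerSeries.expand_injective n hn (HahnSeries.ofPowerSeries_injective hfg))

/-- The embedding `F((T)) → K((S))` with `T ↦ S ^ n`. -/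
noncomputable def LaurentSeries.expandMap (F K : Type*) [Field F] [Field K] [Algebra F K] (n : ℕ)
    (hn : n ≠ 0) : LaurentSeries F →+* LaurentSeries K :=
  IsFractionRing.lift (PowerSeries.expandMap_injective F K n hn)

theorem LaurentSeries.expandMap_ofPowerSeries (F K : Type*) [Field F] [Field K] [Algebra F K]
    (n : ℕ) (hn : n ≠ 0) (f : PowerSeries F) :
    LaurentSeries.expandMap F K n hn (HahnSeries.ofPowerSeries ℤ F f) =
      HahnSeries.ofPowerSeries ℤ K
        (PowerSeries.expand n hn (PowerSeries.map (algebraMap F K) f)) :=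
  IsFractionRing.lift_algebraMap (PowerSeries.expandMap_injective F K n hn) f

theorem LaurentSeries.expandMap_C (F K : Type*) [Field F] [Field K] [Algebra F K]
    (n : ℕ) (hn : n ≠ 0) (c : F) :
    LaurentSeries.expandMap F K n hn (HahnSeries.C c) = HahnSeries.C (algebraMap F K c) := by
  rw [← HahnSeries.ofPowerSeries_C, LaurentSeries.expandMap_ofPowerSeries, PowerSeries.map_C,
    PowerSeries.expand_C, HahnSeries.ofPowerSeries_C]

theorem LaurentSeries.expandMap_single (F K : Type*) [Field F] [Field K] [Algebra F K]
    (n : ℕ) (hn : n ≠ 0) :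
    LaurentSeries.expandMap F K n hn (HahnSeries.single 1 1) = HahnSeries.single 1 1 ^ n := by
  rw [← HahnSeries.ofPowerSeries_X, LaurentSeries.expandMap_ofPowerSeries, PowerSeries.map_X,
    PowerSeries.expand_X, map_pow, HahnSeries.ofPowerSeries_X]

theorem PowerSeries.eq_sum_expand_map {F K ι : Type*} [Field F] [Field K] [Algebra F K]
    [Fintype ι] (b : Module.Basis ι F K) (n : ℕ) (hn : n ≠ 0) (g : PowerSeries K) :
    ∃ a : Fin n → ι → PowerSeries F, g = ∑ i, ∑ m,
      PowerSeries.expand n hn (PowerSeries.map (algebraMap F K) (a i m)) *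
        (PowerSeries.C (b m) * PowerSeries.X ^ (i : ℕ)) := by
  refine ⟨fun i m => PowerSeries.mk fun q => b.repr (PowerSeries.coeff (n * q + i) g) m, ?_⟩
  have hn' : 0 < n := Nat.pos_of_ne_zero hn
  ext N
  have key : ∀ (i : Fin n) (f : PowerSeries K) (c : K), PowerSeries.coeff N
      (PowerSeries.expand n hn f * (PowerSeries.C c * PowerSeries.X ^ (i : ℕ))) =
      if (i : ℕ) = N % n then PowerSeries.coeff (N / n) f * c else 0 := by
    intro i f c
    rw [← mul_assoc, PowerSeries.coeff_mul_X_pow', mul_comm _ (PowerSeries.C c),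
      PowerSeries.coeff_C_mul, PowerSeries.coeff_expand]
    have hi := i.2
    by_cases h : (i : ℕ) = N % n
    · have h1 : (i : ℕ) ≤ N := h ▸ Nat.mod_le _ _
      have h2 : N - i = n * (N / n) := by
        have := Nat.div_add_mod N n
        omega
      rw [if_pos h, if_pos h1, h2, if_pos (dvd_mul_right _ _), Nat.mul_div_cancel_left _ hn',
        mul_comm]
    · rw [if_neg h]
      split_ifs with h1 h2
      · exfalso
        apply h
        obtain ⟨q, hq⟩ := h2
        have : N = i + n * q := by omega
        rw [this, Nat.add_mul_mod_self_left, Nat.mod_eq_of_lt hi]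
      · simp
      · rfl
  simp only [map_sum, key, PowerSeries.coeff_map, PowerSeries.coeff_mk]
  rw [Finset.sum_eq_single (⟨N % n, Nat.mod_lt _ hn'⟩ : Fin n)]
  · simp only [if_true]
    rw [Nat.div_add_mod]
    conv_lhs => rw [← b.sum_repr (PowerSeries.coeff N g)]
    simp [Algebra.smul_def]
  · intro i _ hi
    refine Finset.sum_eq_zero fun m _ => if_neg fun h => hi (Fin.ext h)
  · simp

theorem LaurentSeries.eq_sum_expandMap {F K ι : Type*} [Field F] [Field K] [Algebra F K]
    [Fintype ι] (b : Module.Basis ι F K) (n : ℕ) (hn : n ≠ 0) (f : LaurentSeries K) :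
    ∃ a : Fin n → ι → LaurentSeries F, f = ∑ i, ∑ m,
      LaurentSeries.expandMap F K n hn (a i m) *
        (HahnSeries.C (b m) * HahnSeries.single 1 1 ^ (i : ℕ)) := by
  have hS : (HahnSeries.single 1 1 : LaurentSeries K) ≠ 0 := by simp
  have hT : (HahnSeries.single 1 1 : LaurentSeries F) ≠ 0 := by simp
  obtain ⟨N, hN⟩ : ∃ N : ℕ, 0 ≤ f.order + n * N := by
    refine ⟨f.order.natAbs, ?_⟩
    have : (1 : ℤ) ≤ n := by exact_mod_cast Nat.pos_of_ne_zero hn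
    nlinarith [neg_abs_le f.order, abs_nonneg f.order, Int.natCast_natAbs f.order]
  obtain ⟨e, he⟩ := Int.eq_ofNat_of_zero_le hN
  obtain ⟨a, ha⟩ := PowerSeries.eq_sum_expand_map b n hn (PowerSeries.X ^ e * f.powerSeriesPart)
  have h2 : HahnSeries.single 1 1 ^ (n * N) * f =
      HahnSeries.ofPowerSeries ℤ K (PowerSeries.X ^ e * f.powerSeriesPart) := by
    rw [map_mul, map_pow, HahnSeries.ofPowerSeries_X]
    conv_lhs => rw [← LaurentSeries.single_order_mul_powerSeriesPart f]
    rw [← mul_assoc, RatFunc.single_zpow f.order, ← zpow_natCast, ← zpow_natCast, ← zpow_add₀ hS]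
    congr 2
    push_cast
    linarith
  refine ⟨fun i m => (HahnSeries.single 1 1 ^ N)⁻¹ * HahnSeries.ofPowerSeries ℤ F (a i m), ?_⟩
  apply mul_left_cancel₀ (pow_ne_zero (n * N) hS)
  rw [h2, ha, Finset.mul_sum, map_sum]
  refine Finset.sum_congr rfl fun i _ => ?_
  rw [Finset.mul_sum, map_sum]
  refine Finset.sum_congr rfl fun m _ => ?_
  simp only [map_mul, map_inv₀, map_pow, LaurentSeries.expandMap_ofPowerSeries,
    LaurentSeries.expandMap_single, HahnSeries.ofPowerSeries_C, HahnSeries.ofPowerSeries_X]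
  rw [← pow_mul]
  field_simp

/-- `K((S))` embeds into a separable closure of `F((T))`, with `S` a `p`-th root of `T`; the
image is generated by `K` and `S`. -/
theorem LaurentSeries.exists_embedding (F K : Type) [Field F] [CharZero F] [Field K] [Algebra F K]
    [FiniteDimensional F K] (n : ℕ) (hn : n ≠ 0) :
    ∃ j : LaurentSeries K →+* SeparableClosure (LaurentSeries F),
      (∀ c : F, j (HahnSeries.C (algebraMap F K c)) =
        algebraMap (LaurentSeries F) _ (HahnSeries.C c)) ∧
      j (HahnSeries.single 1 1) ^ n =
        algebraMap (LaurentSeries F) _ (HahnSeries.single 1 1) ∧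
      (∀ f, ∃ f', j f' = algebraMap (LaurentSeries F) _ f) ∧
      ∀ g : SeparableClosure (LaurentSeries F) ≃ₐ[LaurentSeries F]
          SeparableClosure (LaurentSeries F),
        g (j (HahnSeries.single 1 1)) = j (HahnSeries.single 1 1) →
        (∀ k : K, g (j (HahnSeries.C k)) = j (HahnSeries.C k)) → ∀ f, g (j f) = j f := by
  have : CharZero (LaurentSeries F) :=
    charZero_of_injective_ringHom (HahnSeries.C_injective (Γ := ℤ) (R := F))
  classical
  let φ := LaurentSeries.expandMap F K n hn
  let : Algebra (LaurentSeries F) (LaurentSeries K) := φ.toAlgebra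
  have hφ : ∀ x, algebraMap (LaurentSeries F) (LaurentSeries K) x = φ x := fun _ => rfl
  let b := Module.finBasis F K
  have hfin : Module.Finite (LaurentSeries F) (LaurentSeries K) := by
    refine ⟨Finset.univ.image fun im : Fin n × Fin _ =>
      (HahnSeries.C (b im.2) * HahnSeries.single 1 1 ^ (im.1 : ℕ) : LaurentSeries K), ?_⟩
    rw [eq_top_iff]
    rintro f -
    obtain ⟨a, rfl⟩ := LaurentSeries.eq_sum_expandMap b n hn f
    refine Submodule.sum_mem _ fun i _ => Submodule.sum_mem _ fun m _ => ?_
    change algebraMap (LaurentSeries F) (LaurentSeries K) (a i m) * _ ∈ _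
    rw [← Algebra.smul_def]
    refine Submodule.smul_mem _ _ (Submodule.subset_span ?_)
    simp only [Finset.coe_image, Finset.coe_univ, Set.image_univ]
    exact ⟨(i, m), rfl⟩
  let j : LaurentSeries K →ₐ[LaurentSeries F] SeparableClosure (LaurentSeries F) :=
    IsSepClosed.lift
  have hj : ∀ x, j (φ x) = algebraMap _ _ x := j.commutes
  refine ⟨j.toRingHom, fun c => ?_, ?_, fun f => ⟨φ f, hj f⟩, fun g hS hK f => ?_⟩
  · rw [← hj, LaurentSeries.expandMap_C]; rfl
  · rw [← hj, LaurentSeries.expandMap_single, map_pow]; rfl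
  · obtain ⟨a, rfl⟩ := LaurentSeries.eq_sum_expandMap b n hn f
    have hφg : ∀ x, g (j.toRingHom (φ x)) = j.toRingHom (φ x) := fun x => by
      change g (j (φ x)) = j (φ x)
      rw [hj, g.commutes]
    simp only [map_sum, map_mul, map_pow, hS, hK]
    refine Finset.sum_congr rfl fun i _ => Finset.sum_congr rfl fun m _ => ?_
    rw [hφg]

/-- The power `ζ ^ k` of a `p`-th root of unity, for `k` in `ℤ/p`. -/
def rootPow {R : Type*} [Monoid R] {p : ℕ} (ζ : R) (k : ZMod p) : R := ζ ^ k.val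

theorem rootPow_natCast {R : Type*} [Monoid R] {p : ℕ} {ζ : R} (hζ : ζ ^ p = 1) (k : ℕ) :
    rootPow ζ (k : ZMod p) = ζ ^ k := by
  rw [rootPow, ZMod.val_natCast]
  exact (pow_eq_pow_mod k hζ).symm

theorem rootPow_zero {R : Type*} [Monoid R] {p : ℕ} (ζ : R) : rootPow ζ (0 : ZMod p) = 1 := by
  simp [rootPow]

theorem rootPow_add {R : Type*} [Monoid R] {p : ℕ} [NeZero p] {ζ : R} (hζ : ζ ^ p = 1)
    (k l : ZMod p) : rootPow ζ (k + l) = rootPow ζ k * rootPow ζ l := by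
  obtain ⟨a, rfl⟩ := ZMod.natCast_zmod_surjective k
  obtain ⟨b, rfl⟩ := ZMod.natCast_zmod_surjective l
  rw [← Nat.cast_add, rootPow_natCast hζ, rootPow_natCast hζ, rootPow_natCast hζ, pow_add]

theorem rootPow_pow {R : Type*} [Monoid R] {p : ℕ} [NeZero p] {ζ : R} (hζ : ζ ^ p = 1)
    (k : ZMod p) : rootPow ζ k ^ p = 1 := by
  rw [rootPow, ← pow_mul, mul_comm, pow_mul, hζ, one_pow]

theorem rootPow_ne_zero {R : Type*} [Field R] {p : ℕ} [NeZero p] {ζ : R} (hζ : ζ ^ p = 1)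
    (k : ZMod p) : rootPow ζ k ≠ 0 := fun h => by
  have := rootPow_pow hζ k
  rw [h, zero_pow (NeZero.ne p)] at this
  exact zero_ne_one this

theorem IsPrimitiveRoot.rootPow_injective {R : Type*} [CommMonoid R] {p : ℕ} [NeZero p] {ζ : R}
    (hζ : IsPrimitiveRoot ζ p) : Function.Injective (rootPow ζ : ZMod p → R) := fun k l h =>
  ZMod.val_injective p (hζ.pow_inj (ZMod.val_lt k) (ZMod.val_lt l) h)

section Kummer

variable {E Ω : Type*} [Field E] [Field Ω] [Algebra E Ω]

/-- A locally constant character of a group of automorphisms is given by its action on some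
element. -/
theorem exists_kummer_generator {p : ℕ} [NeZero p] {ζ : E} (hζ : ζ ^ p = 1)
    (H : Subgroup (Ω ≃ₐ[E] Ω)) (L : IntermediateField E Ω) [FiniteDimensional E L]
    (ψ : (Ω ≃ₐ[E] Ω) → ZMod p) (hadd : ∀ g ∈ H, ∀ h ∈ H, ψ (g * h) = ψ g + ψ h)
    (hL : ∀ g ∈ H, g ∈ L.fixingSubgroup → ψ g = 0) :
    ∃ ω : Ω, ω ≠ 0 ∧ ∀ g ∈ H, g ω = algebraMap E Ω (rootPow ζ (ψ g)) * ω := by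
  classical
  let N : Subgroup H := L.fixingSubgroup.subgroupOf H
  let v : H ⧸ N → (L →ₐ[E] Ω) := fun q => (q.out.1 : Ω →ₐ[E] Ω).comp L.val
  have hv : ∀ q (u : L), v q u = q.out.1 (u : Ω) := fun _ _ => rfl
  have hN : ∀ (h : H) (u : L), v (h : H ⧸ N) u = h.1 (u : Ω) := by
    intro h u
    have : (h : H ⧸ N).out⁻¹ * h ∈ N := QuotientGroup.eq.mp (by simp)
    have h2 : ((h : H ⧸ N).out⁻¹ * h : H).1 (u : Ω) = u := this u
    rw [hv]
    conv_lhs => rw [← h2]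
    simp
  have hψ : ∀ h : H, ψ ((h : H ⧸ N).out.1) = ψ h.1 := by
    intro h
    have h1 : (h : H ⧸ N).out⁻¹ * h ∈ N := QuotientGroup.eq.mp (by simp)
    have h2 := hL _ ((h : H ⧸ N).out⁻¹ * h).2 h1
    have h3 := hadd _ (h : H ⧸ N).out.2 _ ((h : H ⧸ N).out⁻¹ * h).2
    rw [h2, add_zero] at h3
    rw [← h3]
    simp
  have hvinj : Function.Injective v := by
    intro q r
    induction q using QuotientGroup.induction_on with | _ g =>
    induction r using QuotientGroup.induction_on with | _ h =>
    intro hgh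
    refine QuotientGroup.eq.mpr ?_
    change (g⁻¹ * h).1 ∈ L.fixingSubgroup
    intro u
    have : h.1 (u : Ω) = g.1 u := by rw [← hN, ← hN, hgh]
    simp [this]
  have : Finite (H ⧸ N) := Finite.of_injective v hvinj
  have := Fintype.ofFinite (H ⧸ N)
  let c : H ⧸ N → Ω := fun q => algebraMap E Ω (rootPow ζ (-ψ q.out.1))
  obtain ⟨u, hu⟩ : ∃ u : L, ∑ q, c q * v q u ≠ 0 := by
    by_contra! hcon
    have hli := (linearIndependent_monoidHom L Ω).comp
      (fun q => ((v q : L →* Ω))) (fun q r h => hvinj (AlgHom.ext fun u => DFunLike.congr_fun h u))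
    have := Fintype.linearIndependent_iff.mp hli c (by
      ext u
      simpa using hcon u) ((1 : H) : H ⧸ N)
    exact rootPow_ne_zero hζ _ ((map_eq_zero _).mp this)
  refine ⟨∑ q, c q * v q u, hu, fun g hg => ?_⟩
  rw [map_sum, Finset.mul_sum]
  refine Fintype.sum_equiv (MulAction.toPerm (⟨g, hg⟩ : H)) _ _ fun q => ?_
  induction q using QuotientGroup.induction_on with | _ h =>
  have h1 : (MulAction.toPerm (⟨g, hg⟩ : H)) (h : H ⧸ N) = ((⟨g, hg⟩ * h : H) : H ⧸ N) := rfl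
  rw [h1, map_mul, hN, hN]
  simp only [c]
  rw [AlgEquiv.commutes, hψ, hψ, ← mul_assoc, ← map_mul, ← rootPow_add hζ]
  change _ * g (h.1 u) = algebraMap E Ω (rootPow ζ (ψ g + -ψ (g * h.1))) * g (h.1 u)
  rw [hadd g hg h.1 h.2]
  congr 3
  ring

theorem Nat.Prime.dvd_sum_range {p : ℕ} (hp : p.Prime) (hodd : p ≠ 2) :
    p ∣ ∑ i ∈ Finset.range p, i := by
  obtain ⟨m, hm⟩ := hp.even_sub_one hodd
  rw [Finset.sum_range_id, hm, ← two_mul, Nat.mul_div_assoc _ (dvd_mul_right 2 m)]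
  exact dvd_mul_right _ _

/-- For `p` odd, an eigenvector whose eigenvalue is a `p`-th root of unity has "norm" equal to
its `p`-th power. -/
theorem prod_pow_apply_eq_pow {p : ℕ} [Fact p.Prime] (hodd : p ≠ 2) {ζ : E} (hζ : ζ ^ p = 1)
    {σ : Ω ≃ₐ[E] Ω} {A : Ω} {a : ZMod p} (hA : σ A = algebraMap E Ω (rootPow ζ a) * A) :
    ∏ i ∈ Finset.range p, (σ ^ i) A = A ^ p := by
  have hAi : ∀ i : ℕ, (σ ^ i) A = algebraMap E Ω (rootPow ζ a) ^ i * A := by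
    intro i
    induction i with
    | zero => simp
    | succ i ih =>
      rw [pow_succ, AlgEquiv.mul_apply, hA, map_mul, AlgEquiv.commutes, ih]
      ring
  have hrp : algebraMap E Ω (rootPow ζ a) ^ p = 1 := by
    rw [← map_pow, rootPow_pow hζ, map_one]
  obtain ⟨m, hm⟩ := Nat.Prime.dvd_sum_range Fact.out hodd
  simp_rw [hAi]
  rw [Finset.prod_mul_distrib, Finset.prod_pow_eq_pow_sum, hm, pow_mul, hrp, one_pow, one_mul]
  simp

/-- If the cup product of the characters `α` and `e` vanishes, then `A ^ p`, for `A` a Kummer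
generator of `α`, is a norm from the field cut out by `e`. -/
theorem exists_norm_eq_of_cup_eq_zero {p : ℕ} [Fact p.Prime] (hodd : p ≠ 2) {ζ : E}
    (hζ : ζ ^ p = 1) (H : Subgroup (Ω ≃ₐ[E] Ω)) (L : IntermediateField E Ω)
    [FiniteDimensional E L] (α e y : (Ω ≃ₐ[E] Ω) → ZMod p)
    (he : ∀ g ∈ H, ∀ h ∈ H, e (g * h) = e g + e h)
    (hy : ∀ g ∈ H, ∀ h ∈ H, y (g * h) = y g + y h + α g * e h)
    (hL : ∀ g ∈ H, g ∈ L.fixingSubgroup → y g = 0) {A : Ω}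
    (hA : ∀ g ∈ H, g A = algebraMap E Ω (rootPow ζ (α g)) * A)
    {σ : Ω ≃ₐ[E] Ω} (hσ : σ ∈ H) (heσ : e σ = 1) :
    ∃ z : Ω, (∀ g ∈ H, e g = 0 → g z = z) ∧ ∏ i ∈ Finset.range p, (σ ^ i) z = A ^ p := by
  have he1 : e 1 = 0 := by simpa using he 1 H.one_mem 1 H.one_mem
  have heinv : ∀ g ∈ H, e g⁻¹ = -e g := fun g hg => by
    have := he g hg g⁻¹ (H.inv_mem hg)
    rw [mul_inv_cancel, he1] at this
    exact (neg_eq_of_add_eq_zero_right this.symm).symm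
  let H' : Subgroup (Ω ≃ₐ[E] Ω) :=
    { carrier := {g | g ∈ H ∧ e g = 0}
      mul_mem' := fun {a b} ha hb => ⟨H.mul_mem ha.1 hb.1, by
        rw [he a ha.1 b hb.1, ha.2, hb.2, add_zero]⟩
      one_mem' := ⟨H.one_mem, he1⟩
      inv_mem' := fun {a} ha => ⟨H.inv_mem ha.1, by rw [heinv a ha.1, ha.2, neg_zero]⟩ }
  obtain ⟨ω, hω0, hω⟩ := exists_kummer_generator hζ H' L y
    (fun g hg h hh => by rw [hy g hg.1 h hh.1, hh.2, mul_zero, add_zero])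
    (fun g hg hgL => hL g hg.1 hgL)
  have hpow : ∀ i : ℕ, σ ^ i ∈ H := fun i => H.pow_mem hσ i
  have hepow : ∀ i : ℕ, e (σ ^ i) = i := by
    intro i
    induction i with
    | zero => simpa using he1
    | succ i ih => rw [pow_succ, he _ (hpow i) _ hσ, ih, heσ]; push_cast; rfl
  have hnat : (p : ZMod p) = 0 := CharP.cast_eq_zero _ _
  have htri : ((∑ i ∈ Finset.range p, i : ℕ) : ZMod p) = 0 :=
    (ZMod.natCast_eq_zero_iff _ _).mpr (Nat.Prime.dvd_sum_range Fact.out hodd)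
  refine ⟨A * ω / σ ω, fun g hg heg => ?_, ?_⟩
  · have hgH : g ∈ H' := ⟨hg, heg⟩
    have hg' : σ⁻¹ * g * σ ∈ H := H.mul_mem (H.mul_mem (H.inv_mem hσ) hg) hσ
    have hg'H : σ⁻¹ * g * σ ∈ H' := ⟨hg', by
      rw [he _ (H.mul_mem (H.inv_mem hσ) hg) _ hσ, he _ (H.inv_mem hσ) _ hg, heinv σ hσ, heg]
      ring⟩
    have h1 : y (g * σ) = y g + y σ + α g := by rw [hy g hg σ hσ, heσ, mul_one]
    have h2 : y (g * σ) = y σ + y (σ⁻¹ * g * σ) := by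
      have := hy σ hσ _ hg'
      rw [hg'H.2, mul_zero, add_zero] at this
      rw [← this]
      congr 1
      group
    have h3 : y (σ⁻¹ * g * σ) = y g + α g := by linear_combination h1 - h2
    have h4 : g (σ ω) = algebraMap E Ω (rootPow ζ (y g + α g)) * σ ω := by
      have h5 : g (σ ω) = σ ((σ⁻¹ * g * σ) ω) := by
        rw [← AlgEquiv.mul_apply, ← AlgEquiv.mul_apply]
        congr 1
        group
      rw [h5, hω _ hg'H, h3, map_mul, AlgEquiv.commutes]
    have hσω : σ ω ≠ 0 := (map_ne_zero σ).mpr hω0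
    have hr := (map_ne_zero (algebraMap E Ω)).mpr (rootPow_ne_zero hζ (y g))
    have hr' := (map_ne_zero (algebraMap E Ω)).mpr (rootPow_ne_zero hζ (α g))
    rw [map_div₀, map_mul, hA g hg, hω g hgH, h4, rootPow_add hζ, map_mul]
    field_simp
  · have hprod : ∀ n : ℕ, ∏ i ∈ Finset.range n, (σ ^ i) (A * ω / σ ω) =
        (∏ i ∈ Finset.range n, (σ ^ i) A) * (ω / (σ ^ n) ω) := by
      intro n
      induction n with
      | zero => simp [hω0]
      | succ n ih =>
        rw [Finset.prod_range_succ, Finset.prod_range_succ, ih, map_div₀, map_mul]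
        have h1 : (σ ^ n) (σ ω) = (σ ^ (n + 1)) ω := by rw [pow_succ, AlgEquiv.mul_apply]
        have h2 : (σ ^ n) ω ≠ 0 := (map_ne_zero _).mpr hω0
        have h3 : (σ ^ (n + 1)) ω ≠ 0 := (map_ne_zero _).mpr hω0
        rw [h1]
        field_simp
    have hAprod : ∏ i ∈ Finset.range p, (σ ^ i) A = A ^ p :=
      prod_pow_apply_eq_pow hodd hζ (hA σ hσ)
    have hypow : ∀ n : ℕ, y (σ ^ n) = n * y σ + α σ * (∑ i ∈ Finset.range n, i : ℕ) := by
      intro n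
      induction n with
      | zero =>
        have := hy 1 H.one_mem 1 H.one_mem
        rw [he1, mul_one, mul_zero, add_zero] at this
        simpa using this
      | succ n ih =>
        rw [pow_succ', hy σ hσ _ (hpow n), ih, hepow, Finset.sum_range_succ]
        push_cast
        ring
    have hσp : (σ ^ p) ω = ω := by
      rw [hω (σ ^ p) ⟨hpow p, by rw [hepow, hnat]⟩, hypow, htri, hnat, zero_mul, mul_zero,
        add_zero, rootPow_zero, map_one, one_mul]
    rw [hprod, hAprod, hσp, div_self hω0, mul_one]

end Kummer

section PrimeSquare

variable {p : ℕ}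

/-- The injection `ℤ/p → ℤ/p²` given by multiplication by `p`. -/
def ZMod.mulPrime (k : ZMod p) : ZMod (p ^ 2) := p * (k.val : ZMod (p ^ 2))

theorem ZMod.mulPrime_natCast (k : ℕ) : ZMod.mulPrime (k : ZMod p) = p * (k : ZMod (p ^ 2)) := by
  rw [mulPrime, ZMod.val_natCast]
  norm_cast
  rw [ZMod.natCast_eq_natCast_iff, pow_two]
  exact Nat.ModEq.mul_left' p (Nat.mod_modEq k p)

/-- The reduction `ℤ/p² → ℤ/p`. -/
abbrev ZMod.reduction (p : ℕ) : ZMod (p ^ 2) →+* ZMod p :=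
  ZMod.castHom (dvd_pow_self p two_ne_zero) (ZMod p)

variable [NeZero p]

theorem ZMod.mulPrime_add (k l : ZMod p) :
    ZMod.mulPrime (k + l) = ZMod.mulPrime k + ZMod.mulPrime l := by
  obtain ⟨a, rfl⟩ := ZMod.natCast_zmod_surjective k
  obtain ⟨b, rfl⟩ := ZMod.natCast_zmod_surjective l
  rw [← Nat.cast_add, mulPrime_natCast, mulPrime_natCast, mulPrime_natCast]
  push_cast
  ring

theorem ZMod.mulPrime_injective : Function.Injective (ZMod.mulPrime : ZMod p → ZMod (p ^ 2)) := by
  intro k l h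
  obtain ⟨a, rfl⟩ := ZMod.natCast_zmod_surjective k
  obtain ⟨b, rfl⟩ := ZMod.natCast_zmod_surjective l
  rw [mulPrime_natCast, mulPrime_natCast, ← Nat.cast_mul, ← Nat.cast_mul,
    ZMod.natCast_eq_natCast_iff, pow_two] at h
  rw [ZMod.natCast_eq_natCast_iff]
  exact Nat.ModEq.mul_left_cancel' (NeZero.ne p) h

theorem ZMod.mul_mulPrime (x : ZMod (p ^ 2)) (k : ZMod p) :
    x * ZMod.mulPrime k = ZMod.mulPrime (ZMod.reduction p x * k) := by
  obtain ⟨a, rfl⟩ := ZMod.natCast_zmod_surjective x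
  obtain ⟨b, rfl⟩ := ZMod.natCast_zmod_surjective k
  rw [map_natCast, ← Nat.cast_mul, mulPrime_natCast, mulPrime_natCast]
  push_cast
  ring

theorem ZMod.exists_eq_mulPrime {x : ZMod (p ^ 2)} (hx : ZMod.reduction p x = 0) :
    ∃ k, x = ZMod.mulPrime k := by
  obtain ⟨a, rfl⟩ := ZMod.natCast_zmod_surjective x
  rw [map_natCast, ZMod.natCast_eq_zero_iff] at hx
  obtain ⟨m, rfl⟩ := hx
  exact ⟨m, by rw [mulPrime_natCast]; push_cast; rfl⟩

theorem ZMod.reduction_mulPrime (k : ZMod p) : ZMod.reduction p (ZMod.mulPrime k) = 0 := by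
  simp [ZMod.mulPrime]

theorem ZMod.mul_eq_zero_of_reduction_eq_zero {x y : ZMod (p ^ 2)} (hx : ZMod.reduction p x = 0)
    (hy : ZMod.reduction p y = 0) : x * y = 0 := by
  obtain ⟨k, rfl⟩ := exists_eq_mulPrime hy
  rw [mul_mulPrime, hx, zero_mul]
  simp [mulPrime]

/-- Two cocycles with values in rank one modules over `ℤ/p²` which agree modulo `p` differ
by a nullhomotopy of the cup product of their reduction with the difference of the twists. -/
theorem exists_cochain_of_cocycles {G : Type*} [Group G] (H : Subgroup G)
    {X A : G → ZMod (p ^ 2)} {α δ κ : G → ZMod p}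
    (hX : ∀ g ∈ H, ∀ h ∈ H, X (g * h) = X g + (1 + ZMod.mulPrime (δ g)) * X h)
    (hA : ∀ g ∈ H, ∀ h ∈ H, A (g * h) = A g + (1 + ZMod.mulPrime (κ g)) * A h)
    (hXα : ∀ g ∈ H, ZMod.reduction p (X g) = α g)
    (hAα : ∀ g ∈ H, ZMod.reduction p (A g) = α g) :
    ∃ y : G → ZMod p, (∀ g ∈ H, ∀ h ∈ H, y (g * h) = y g + y h + (δ g - κ g) * α h) ∧
      ∀ g ∈ H, X g = 0 → A g = 0 → y g = 0 := by
  have hex : ∀ g, ∃ k, g ∈ H → X g - A g = ZMod.mulPrime k := fun g => by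
    by_cases hg : g ∈ H
    · obtain ⟨k, hk⟩ := ZMod.exists_eq_mulPrime (x := X g - A g)
        (by rw [map_sub, hXα g hg, hAα g hg, sub_self])
      exact ⟨k, fun _ => hk⟩
    · exact ⟨0, fun h => absurd h hg⟩
  choose y hy using hex
  refine ⟨y, fun g hg h hh => ?_, fun g hg h1 h2 => ?_⟩
  · apply ZMod.mulPrime_injective
    have hsplit : (δ g - κ g) * α h + κ g * α h = δ g * α h := by ring
    have h1 := congrArg ZMod.mulPrime hsplit
    have h2 := ZMod.mul_mulPrime (X h) (δ g)
    have h3 := ZMod.mul_mulPrime (A h) (κ g)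
    rw [hXα h hh, mul_comm (α h)] at h2
    rw [hAα h hh, mul_comm (α h)] at h3
    rw [ZMod.mulPrime_add] at h1
    rw [ZMod.mulPrime_add, ZMod.mulPrime_add, ← hy g hg, ← hy h hh, ← hy _ (H.mul_mem hg hh),
      hX g hg h hh, hA g hg h hh]
    linear_combination h2 - h3 - h1
  · apply ZMod.mulPrime_injective
    rw [← hy g hg, h1, h2]
    simp [ZMod.mulPrime]

/-- The properties of the entries of a representation in upper triangular `3 × 3` matrices
over `ℤ/p²` that is unitriangular modulo `p`. -/
theorem exists_cocycles_of_isUpperTri {G : Type*} [Group G] (ρ : G →* GL (Fin 3) (ZMod (p ^ 2)))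
    (hρ : ∀ g, IsUpperTri (ρ g))
    (hdiag : ∀ g i, ZMod.reduction p ((ρ g).val i i) = 1) :
    ∃ δ₁ δ₂ : G → ZMod p, (∀ g h, δ₁ (g * h) = δ₁ g + δ₁ h) ∧ (∀ g h, δ₂ (g * h) = δ₂ g + δ₂ h) ∧
    (∀ g, ρ g = 1 → δ₁ g = 0 ∧ δ₂ g = 0) ∧
    ∃ X₁ X₂ X₃ : G → ZMod (p ^ 2),
      (∀ g h, X₁ (g * h) = X₁ g + (1 + ZMod.mulPrime (δ₁ g)) * X₁ h) ∧
      (∀ g h, X₂ (g * h) = X₂ g + (1 + ZMod.mulPrime (δ₂ g)) * X₂ h) ∧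
      (∀ g h, ZMod.reduction p ((ρ g).val 0 1) = 0 →
        ZMod.reduction p ((ρ h).val 1 2) = 0 →
        X₃ (g * h) = X₃ g + (1 + ZMod.mulPrime (δ₁ g + δ₂ g)) * X₃ h) ∧
      (∀ g, ZMod.reduction p (X₁ g) = ZMod.reduction p ((ρ g).val 0 1)) ∧
      (∀ g, ZMod.reduction p (X₂ g) = ZMod.reduction p ((ρ g).val 1 2)) ∧
      (∀ g, ZMod.reduction p (X₃ g) = ZMod.reduction p ((ρ g).val 0 2)) ∧
      ∀ g, ρ g = 1 → X₁ g = 0 ∧ X₂ g = 0 ∧ X₃ g = 0 := by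
  let M : G → Matrix (Fin 3) (Fin 3) (ZMod (p ^ 2)) := fun g => ρ g
  have hM : ∀ g, (ρ g).val = M g := fun _ => rfl
  have hmul : ∀ g h, M (g * h) = M g * M h := fun g h => by simp [M]
  have hone : ∀ g, ρ g = 1 → M g = 1 := fun g hg => by simp [M, hg]
  have hM1 : M 1 = 1 := hone 1 (map_one ρ)
  simp only [hM] at hdiag ⊢
  have h10 : ∀ g, M g 1 0 = 0 := fun g => hρ g 1 0 (by decide)
  have h20 : ∀ g, M g 2 0 = 0 := fun g => hρ g 2 0 (by decide)
  have h21 : ∀ g, M g 2 1 = 0 := fun g => hρ g 2 1 (by decide)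
  have m00 : ∀ g h, M (g * h) 0 0 = M g 0 0 * M h 0 0 := fun g h => by
    simp [hmul, Matrix.mul_apply, Fin.sum_univ_three, h10, h20]
  have m11 : ∀ g h, M (g * h) 1 1 = M g 1 1 * M h 1 1 := fun g h => by
    simp [hmul, Matrix.mul_apply, Fin.sum_univ_three, h10, h21]
  have m22 : ∀ g h, M (g * h) 2 2 = M g 2 2 * M h 2 2 := fun g h => by
    simp [hmul, Matrix.mul_apply, Fin.sum_univ_three, h20, h21]
  have m01 : ∀ g h, M (g * h) 0 1 = M g 0 0 * M h 0 1 + M g 0 1 * M h 1 1 := fun g h => by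
    simp [hmul, Matrix.mul_apply, Fin.sum_univ_three, h21]
  have m12 : ∀ g h, M (g * h) 1 2 = M g 1 1 * M h 1 2 + M g 1 2 * M h 2 2 := fun g h => by
    simp [hmul, Matrix.mul_apply, Fin.sum_univ_three, h10]
  have m02 : ∀ g h, M (g * h) 0 2 = M g 0 0 * M h 0 2 + M g 0 1 * M h 1 2 + M g 0 2 * M h 2 2 :=
    fun g h => by simp [hmul, Matrix.mul_apply, Fin.sum_univ_three]
  have i11 : ∀ g, M g 1 1 * M g⁻¹ 1 1 = 1 := fun g => by rw [← m11, mul_inv_cancel, hM1]; simp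
  have i22 : ∀ g, M g 2 2 * M g⁻¹ 2 2 = 1 := fun g => by rw [← m22, mul_inv_cancel, hM1]; simp
  have hex : ∀ i j g, ∃ k, M g i i * M g⁻¹ j j = 1 + ZMod.mulPrime k := fun i j g => by
    obtain ⟨k, hk⟩ := ZMod.exists_eq_mulPrime (x := M g i i * M g⁻¹ j j - 1)
      (by rw [map_sub, map_mul, hdiag, hdiag, map_one, one_mul, sub_self])
    exact ⟨k, by rw [← hk]; ring⟩
  choose δ₁ hδ₁ using hex 0 1
  choose δ₂ hδ₂ using hex 1 2
  have hzero : ∀ k : ZMod p, 1 + ZMod.mulPrime k = 1 → k = 0 := fun k hk => by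
    apply ZMod.mulPrime_injective
    rw [add_eq_left.mp hk]
    simp [ZMod.mulPrime]
  have hadd : ∀ k l : ZMod p, (1 + ZMod.mulPrime k) * (1 + ZMod.mulPrime l) =
      1 + ZMod.mulPrime (k + l) := fun k l => by
    have := ZMod.mul_eq_zero_of_reduction_eq_zero (ZMod.reduction_mulPrime k)
      (ZMod.reduction_mulPrime l)
    rw [ZMod.mulPrime_add]
    linear_combination this
  have hcancel : ∀ k l : ZMod p, 1 + ZMod.mulPrime k = 1 + ZMod.mulPrime l → k = l := fun k l h =>
    ZMod.mulPrime_injective (add_left_cancel h)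
  have hδ₃ : ∀ g, M g 0 0 * M g⁻¹ 2 2 = 1 + ZMod.mulPrime (δ₁ g + δ₂ g) := fun g => by
    rw [← hadd, ← hδ₁, ← hδ₂]
    linear_combination (-(M g 0 0 * M g⁻¹ 2 2)) * i11 g
  refine ⟨δ₁, δ₂, fun g h => hcancel _ _ ?_, fun g h => hcancel _ _ ?_, fun g hg => ⟨?_, ?_⟩,
    fun g => M g 0 1 * M g⁻¹ 1 1, fun g => M g 1 2 * M g⁻¹ 2 2, fun g => M g 0 2 * M g⁻¹ 2 2,
    fun g h => ?_, fun g h => ?_, fun g h hg hh => ?_, fun g => ?_, fun g => ?_, fun g => ?_,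
    fun g hg => ?_⟩
  · rw [← hadd, ← hδ₁, ← hδ₁, ← hδ₁, mul_inv_rev, m00, m11]
    ring
  · rw [← hadd, ← hδ₂, ← hδ₂, ← hδ₂, mul_inv_rev, m11, m22]
    ring
  · refine hzero _ ?_
    rw [← hδ₁, hone g hg, hone g⁻¹ (by simp [hg])]
    simp
  · refine hzero _ ?_
    rw [← hδ₂, hone g hg, hone g⁻¹ (by simp [hg])]
    simp
  · simp only [mul_inv_rev, ← hδ₁, m01, m11]
    linear_combination (M g 0 1 * M g⁻¹ 1 1) * i11 h
  · simp only [mul_inv_rev, ← hδ₂, m12, m22]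
    linear_combination (M g 1 2 * M g⁻¹ 2 2) * i22 h
  · have h0 := ZMod.mul_eq_zero_of_reduction_eq_zero hg hh
    simp only [mul_inv_rev, ← hδ₃, m02, m22]
    linear_combination (M g 0 2 * M g⁻¹ 2 2) * i22 h + (M h⁻¹ 2 2 * M g⁻¹ 2 2) * h0
  · rw [map_mul, hdiag, mul_one]
  · rw [map_mul, hdiag, mul_one]
  · rw [map_mul, hdiag, mul_one]
  · simp [hone g hg]

end PrimeSquare

section NormNonSurjectivity

open scoped ENNReal

theorem Multiset.disjSum_injective {α β : Type*} :
    Function.Injective fun m : Multiset α × Multiset β => m.1.disjSum m.2 := by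
  classical
  rintro ⟨a, b⟩ ⟨c, d⟩ h
  have h1 : ∀ x, Multiset.count x (a.disjSum b) = Multiset.count x (c.disjSum d) := fun x => by
    rw [show a.disjSum b = c.disjSum d from h]
  have hl : ∀ (a : Multiset α) (b : Multiset β) x, (a.disjSum b).count (Sum.inl x) = a.count x := by
    intro a b x
    rw [Multiset.disjSum, Multiset.count_add,
      Multiset.count_map_eq_count' _ _ Sum.inl_injective,
      Multiset.count_eq_zero_of_notMem (s := b.map Sum.inr) (by simp), add_zero]
  have hr : ∀ (a : Multiset α) (b : Multiset β) x, (a.disjSum b).count (Sum.inr x) = b.count x := by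
    intro a b x
    rw [Multiset.disjSum, Multiset.count_add,
      Multiset.count_map_eq_count' _ _ Sum.inr_injective,
      Multiset.count_eq_zero_of_notMem (s := a.map Sum.inl) (by simp), zero_add]
  refine Prod.ext (Multiset.ext.mpr fun x => ?_) (Multiset.ext.mpr fun x => ?_)
  · rw [← hl a b, ← hl c d, h1]
  · rw [← hr a b, ← hr c d, h1]

/-- The sum over all multisets of the product of the weights of their elements, that is the
Euler product with Euler factors `1 / (1 - w a)`. -/
noncomputable def multisetSum {α : Type*} (w : α → ℝ≥0∞) : ℝ≥0∞ :=
  ∑' m : Multiset α, (m.map w).prod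

theorem multisetSum_le_of_injective {α β : Type*} {f : α → β} (hf : Function.Injective f)
    (w : β → ℝ≥0∞) : multisetSum (w ∘ f) ≤ multisetSum w := by
  have := ENNReal.tsum_comp_le_tsum_of_injective (Multiset.map_injective hf)
    (fun m => (m.map w).prod)
  simpa only [multisetSum, Multiset.map_map] using this

theorem multisetSum_mul_le {α β : Type*} (w : α ⊕ β → ℝ≥0∞) :
    multisetSum (w ∘ Sum.inl) * multisetSum (w ∘ Sum.inr) ≤ multisetSum w := by
  have := ENNReal.tsum_comp_le_tsum_of_injective Multiset.disjSum_injective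
    (fun m => (m.map w).prod)
  refine le_trans (le_of_eq ?_) this
  rw [multisetSum, multisetSum, ← ENNReal.tsum_mul_right, ENNReal.tsum_prod']
  refine tsum_congr fun a => ?_
  rw [← ENNReal.tsum_mul_left]
  refine tsum_congr fun b => ?_
  rw [Multiset.disjSum, Multiset.map_add, Multiset.map_map, Multiset.map_map, Multiset.prod_add]

theorem multisetSum_le_two_pow_mul {α : Type*} (w : α → ℝ≥0∞) (S : Finset α)
    (hw : ∀ a ∈ S, w a ≤ 2⁻¹) (hfin : multisetSum w ≠ ∞) :
    multisetSum w ≤ 2 ^ S.card * multisetSum fun a : {a // a ∉ S} => w a := by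
  classical
  let f : Finset α → Multiset α → ℝ≥0∞ := fun S m => if ∀ a ∈ m, a ∉ S then (m.map w).prod else 0
  have hle : ∀ S, ∑' m, f S m ≤ multisetSum w := fun S =>
    ENNReal.tsum_le_tsum fun m => by
      simp only [f]
      split_ifs
      exacts [le_rfl, zero_le]
  have key : ∀ T ⊆ S, multisetSum w ≤ 2 ^ T.card * ∑' m, f T m := by
    intro T
    induction T using Finset.induction_on with
    | empty => intro; simp [f, multisetSum]
    | insert a T haT ih =>
      intro hTS
      have hstep : ∑' m, f T m ≤ 2 * ∑' m, f (insert a T) m := by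
        have h1 : ∀ m, f T m = f (insert a T) m + if a ∈ m then f T m else 0 := by
          intro m
          by_cases ham : a ∈ m
          · have : ¬ ∀ b ∈ m, b ∉ insert a T := fun h => h a ham (Finset.mem_insert_self _ _)
            simp only [f, if_neg this, ham, if_true, zero_add]
          · have : (∀ b ∈ m, b ∉ insert a T) ↔ ∀ b ∈ m, b ∉ T := by
              refine forall₂_congr fun b hb => ?_
              have : b ≠ a := fun h => ham (h ▸ hb)
              simp [this]
            simp only [f, this, ham, if_false, add_zero]
        have h2 : ∑' m, (if a ∈ m then f T m else 0) = w a * ∑' m, f T m := by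
          rw [← ENNReal.tsum_mul_left]
          have hinj : Function.Injective fun m : Multiset α => a ::ₘ m :=
            fun m n h => (Multiset.cons_inj_right a).mp h
          rw [← hinj.tsum_eq (f := fun m => if a ∈ m then f T m else 0)]
          · refine tsum_congr fun m => ?_
            simp [f, haT]
          · intro m hm
            by_cases ham : a ∈ m
            · exact ⟨m.erase a, Multiset.cons_erase ham⟩
            · simp [ham] at hm
        have h3 : ∑' m, f T m ≤ ∑' m, f (insert a T) m + 2⁻¹ * ∑' m, f T m := by
          conv_lhs => rw [tsum_congr h1, ENNReal.tsum_add, h2]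
          gcongr
          exact hw a (hTS (Finset.mem_insert_self _ _))
        have hT : ∑' m, f T m ≠ ∞ := ne_top_of_le_ne_top hfin (hle T)
        have hT' : ∑' m, f (insert a T) m ≠ ∞ := ne_top_of_le_ne_top hfin (hle _)
        have h4 := ENNReal.toReal_mono (by finiteness) h3
        rw [ENNReal.toReal_add hT' (by finiteness), ENNReal.toReal_mul] at h4
        rw [← ENNReal.toReal_le_toReal hT (by finiteness), ENNReal.toReal_mul]
        norm_num at h4 ⊢
        linarith
      rw [Finset.card_insert_of_notMem haT, pow_succ, mul_assoc]
      exact (ih ((Finset.subset_insert _ _).trans hTS)).trans (by gcongr)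
  refine (key S subset_rfl).trans ?_
  gcongr
  have hinj : Function.Injective (Multiset.map (Subtype.val : {a // a ∉ S} → α)) :=
    Multiset.map_injective Subtype.val_injective
  rw [← hinj.tsum_eq (f := f S)]
  · refine (ENNReal.tsum_le_tsum fun m => ?_)
    simp only [f]
    split_ifs
    · rw [Multiset.map_map]; rfl
    · exact zero_le
  · intro m hm
    have : ∀ a ∈ m, a ∉ S := by
      by_contra hcon
      exact hm (if_neg hcon)
    exact ⟨m.pmap Subtype.mk this, by rw [Multiset.map_pmap, Multiset.pmap_eq_map, Multiset.map_id']⟩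

open NumberField IsDedekindDomain Filter Topology

theorem IsDedekindDomain.HeightOneSpectrum.bijective_prod_map {R : Type*} [CommRing R]
    [IsDedekindDomain R] : Function.Bijective fun m : Multiset (HeightOneSpectrum R) =>
      (⟨(m.map HeightOneSpectrum.asIdeal).prod, by
        rw [← Ideal.zero_eq_bot, Ne, Multiset.prod_eq_zero_iff, Multiset.mem_map]
        rintro ⟨v, -, hv⟩
        exact v.ne_bot hv⟩ :
        {I : Ideal R // I ≠ ⊥}) := by
  classical
  constructor
  · intro m n h
    have h1 := congrArg UniqueFactorizationMonoid.normalizedFactors (Subtype.ext_iff.mp h)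
    simp only at h1
    rw [UniqueFactorizationMonoid.normalizedFactors_prod_of_prime,
      UniqueFactorizationMonoid.normalizedFactors_prod_of_prime] at h1
    · exact Multiset.map_injective (fun v w h => HeightOneSpectrum.ext h) h1
    · simpa using fun v : HeightOneSpectrum R => fun _ => v.prime
    · simpa using fun v : HeightOneSpectrum R => fun _ => v.prime
  · rintro ⟨I, hI⟩
    refine ⟨(UniqueFactorizationMonoid.normalizedFactors I).pmap
      (fun P (hP : Prime P) => ⟨P, Ideal.isPrime_of_prime hP, hP.ne_zero⟩)
      (fun P hP => UniqueFactorizationMonoid.prime_of_normalized_factor P hP), ?_⟩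
    ext1
    simp only [Multiset.map_pmap, Multiset.pmap_eq_map, Multiset.map_id']
    exact Ideal.prod_normalizedFactors_eq_self hI

theorem NumberField.tendsto_sub_one_mul_multisetSum (K : Type*) [Field K] [NumberField K] :
    (∀ᶠ s : ℝ in 𝓝[>] 1, multisetSum (fun v : HeightOneSpectrum (𝓞 K) =>
      ENNReal.ofReal ((Ideal.absNorm v.asIdeal : ℝ) ^ (-s))) ≠ ∞) ∧
    Tendsto (fun s : ℝ => (s - 1) * (multisetSum fun v : HeightOneSpectrum (𝓞 K) =>
      ENNReal.ofReal ((Ideal.absNorm v.asIdeal : ℝ) ^ (-s))).toReal) (𝓝[>] 1)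
      (𝓝 (dedekindZeta_residue K)) := by
  have hlim := tendsto_sub_one_mul_dedekindZeta_nhdsGT K
  have hne : ∀ᶠ s : ℝ in 𝓝[>] 1, 1 < s ∧ dedekindZeta K s ≠ 0 := by
    have h0 : (dedekindZeta_residue K : ℂ) ≠ 0 := by
      exact_mod_cast dedekindZeta_residue_ne_zero K
    filter_upwards [hlim.eventually_ne h0, self_mem_nhdsWithin] with s hs h1
    exact ⟨h1, right_ne_zero_of_mul hs⟩
  have key : ∀ s : ℝ, 1 < s → dedekindZeta K s ≠ 0 →
      multisetSum (fun v : HeightOneSpectrum (𝓞 K) =>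
        ENNReal.ofReal ((Ideal.absNorm v.asIdeal : ℝ) ^ (-s))) ≠ ∞ ∧
      dedekindZeta K s = ((multisetSum (fun v : HeightOneSpectrum (𝓞 K) =>
        ENNReal.ofReal ((Ideal.absNorm v.asIdeal : ℝ) ^ (-s)))).toReal : ℂ) := by
    intro s hs h0
    let a : ℕ → ℝ := fun n => if n = 0 then 0 else
      Nat.card {I : Ideal (𝓞 K) // Ideal.absNorm I = n} * (n : ℝ) ^ (-s)
    have ha : ∀ n, 0 ≤ a n := fun n => by
      simp only [a]
      split_ifs
      · exact le_rfl
      · positivity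
    have hterm : ∀ n, LSeries.term
        (fun n => (Nat.card {I : Ideal (𝓞 K) // Ideal.absNorm I = n} : ℂ)) s n = (a n : ℂ) := by
      intro n
      rw [LSeries.term_def]
      simp only [a]
      split_ifs with hn
      · simp
      · rw [Complex.ofReal_mul, Complex.ofReal_cpow (by positivity)]
        simp [Complex.cpow_neg, div_eq_mul_inv]
    have hsum : LSeriesSummable
        (fun n => (Nat.card {I : Ideal (𝓞 K) // Ideal.absNorm I = n} : ℂ)) s := by
      by_contra hcon
      exact h0 (LSeries.eq_zero_of_not_LSeriesSummable _ _ hcon)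
    have hsum' : Summable a := by
      rw [LSeriesSummable, funext hterm] at hsum
      exact Complex.summable_ofReal.mp hsum
    have hzeta : dedekindZeta K s = ((∑' n, a n : ℝ) : ℂ) := by
      rw [dedekindZeta, LSeries, tsum_congr hterm, Complex.ofReal_tsum]
    have hms : multisetSum (fun v : HeightOneSpectrum (𝓞 K) =>
        ENNReal.ofReal ((Ideal.absNorm v.asIdeal : ℝ) ^ (-s))) = ∑' n, ENNReal.ofReal (a n) := by
      let e := Equiv.ofBijective _ (HeightOneSpectrum.bijective_prod_map (R := 𝓞 K))
      have h1 : ∀ m : Multiset (HeightOneSpectrum (𝓞 K)), (m.map fun v =>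
          ENNReal.ofReal ((Ideal.absNorm v.asIdeal : ℝ) ^ (-s))).prod =
          ENNReal.ofReal ((Ideal.absNorm (e m).1 : ℝ) ^ (-s)) := by
        intro m
        change _ = ENNReal.ofReal ((Ideal.absNorm (m.map HeightOneSpectrum.asIdeal).prod : ℝ) ^ (-s))
        induction m using Multiset.induction_on with
        | empty => simp
        | cons v m ih =>
          rw [Multiset.map_cons, Multiset.prod_cons, ih, Multiset.map_cons, Multiset.prod_cons,
            map_mul, Nat.cast_mul, Real.mul_rpow (by positivity) (by positivity),
            ENNReal.ofReal_mul (by positivity)]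
      rw [multisetSum, tsum_congr h1, e.tsum_eq
        (fun I : {I : Ideal (𝓞 K) // I ≠ ⊥} => ENNReal.ofReal ((Ideal.absNorm I.1 : ℝ) ^ (-s)))]
      let N : {I : Ideal (𝓞 K) // I ≠ ⊥} → ℕ := fun I => Ideal.absNorm I.1
      rw [← (Equiv.sigmaFiberEquiv N).tsum_eq, ENNReal.tsum_sigma']
      refine tsum_congr fun n => ?_
      have h2 : ∀ I : {I // N I = n}, ENNReal.ofReal ((Ideal.absNorm
          ((Equiv.sigmaFiberEquiv N) ⟨n, I⟩).1 : ℝ) ^ (-s)) = ENNReal.ofReal ((n : ℝ) ^ (-s)) := by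
        intro I
        have : Ideal.absNorm ((Equiv.sigmaFiberEquiv N) ⟨n, I⟩).1 = n := I.2
        rw [this]
      rw [tsum_congr h2]
      simp only [a]
      split_ifs with hn
      · have : IsEmpty {I // N I = n} := ⟨fun I => I.1.2
          (Ideal.absNorm_eq_zero_iff.mp (I.2.trans hn))⟩
        simp
      · have e2 : {I // N I = n} ≃ {I : Ideal (𝓞 K) // Ideal.absNorm I = n} :=
          { toFun := fun I => ⟨I.1.1, I.2⟩
            invFun := fun I => ⟨⟨I.1, fun h => hn (by rw [← I.2, h, Ideal.absNorm_bot])⟩, I.2⟩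
            left_inv := fun _ => rfl
            right_inv := fun _ => rfl }
        have : Finite {I : Ideal (𝓞 K) // Ideal.absNorm I = n} :=
          (Ideal.finite_setOfPred_absNorm_eq n).to_subtype
        rw [ENNReal.tsum_const, ENat.card_congr e2, ENNReal.ofReal_mul (by positivity),
          ENNReal.ofReal_natCast, ENat.card_eq_coe_natCard]
        simp
    rw [hms, hzeta, ← ENNReal.ofReal_tsum_of_nonneg ha hsum']
    exact ⟨ENNReal.ofReal_ne_top, by rw [ENNReal.toReal_ofReal (tsum_nonneg ha)]⟩
  refine ⟨hne.mono fun s hs => (key s hs.1 hs.2).1, ?_⟩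
  have h3 := (Complex.continuous_re.tendsto _).comp hlim
  rw [Complex.ofReal_re] at h3
  refine h3.congr' (hne.mono fun s hs => ?_)
  rw [Function.comp_apply, (key s hs.1 hs.2).2, ← Complex.ofReal_one, ← Complex.ofReal_sub,
    ← Complex.ofReal_mul, Complex.ofReal_re]

/-- There is no norm-preserving way to choose two distinct primes of `K` for almost all primes
of `F`. -/
theorem NumberField.not_exists_pair_of_primes (F K : Type*) [Field F] [NumberField F] [Field K]
    [NumberField K] (S : Finset (HeightOneSpectrum (𝓞 F)))
    (f : {v // v ∉ S} ⊕ {v // v ∉ S} → HeightOneSpectrum (𝓞 K)) (hf : Function.Injective f)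
    (hl : ∀ v, Ideal.absNorm (f (Sum.inl v)).asIdeal = Ideal.absNorm v.1.asIdeal)
    (hr : ∀ v, Ideal.absNorm (f (Sum.inr v)).asIdeal = Ideal.absNorm v.1.asIdeal) : False := by
  obtain ⟨hF, hlF⟩ := tendsto_sub_one_mul_multisetSum F
  obtain ⟨hK, hlK⟩ := tendsto_sub_one_mul_multisetSum K
  set ZF : ℝ → ℝ≥0∞ := fun s => multisetSum fun v : HeightOneSpectrum (𝓞 F) =>
      ENNReal.ofReal ((Ideal.absNorm v.asIdeal : ℝ) ^ (-s)) with hZF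
  set ZK : ℝ → ℝ≥0∞ := fun s => multisetSum fun v : HeightOneSpectrum (𝓞 K) =>
      ENNReal.ofReal ((Ideal.absNorm v.asIdeal : ℝ) ^ (-s)) with hZK
  have hle : ∀ᶠ s : ℝ in 𝓝[>] 1, ((s - 1) * (ZF s).toReal) ^ 2 ≤
      (2 ^ S.card) ^ 2 * ((s - 1) * ((s - 1) * (ZK s).toReal)) := by
    filter_upwards [hF, hK, self_mem_nhdsWithin] with s hsF hsK hs
    have hs : 1 < s := hs
    let w : HeightOneSpectrum (𝓞 F) → ℝ≥0∞ := fun v =>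
      ENNReal.ofReal ((Ideal.absNorm v.asIdeal : ℝ) ^ (-s))
    have h1 : ZF s ≤ 2 ^ S.card * multisetSum fun v : {v // v ∉ S} => w v := by
      refine multisetSum_le_two_pow_mul w S (fun v _ => ?_) hsF
      have h2 : 2 ≤ Ideal.absNorm v.asIdeal := by
        have h0 : Ideal.absNorm v.asIdeal ≠ 0 := fun h =>
          v.ne_bot (Ideal.absNorm_eq_zero_iff.mp h)
        have h1 : Ideal.absNorm v.asIdeal ≠ 1 := fun h =>
          v.isPrime.ne_top (Ideal.absNorm_eq_one_iff.mp h)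
        omega
      have h2' : (2 : ℝ) ≤ Ideal.absNorm v.asIdeal := by exact_mod_cast h2
      rw [show (2 : ℝ≥0∞)⁻¹ = ENNReal.ofReal (2⁻¹) by
        rw [ENNReal.ofReal_inv_of_pos two_pos]; norm_num]
      refine ENNReal.ofReal_le_ofReal ?_
      rw [Real.rpow_neg (by positivity)]
      refine inv_anti₀ two_pos (h2'.trans ?_)
      exact Real.self_le_rpow_of_one_le (by linarith) hs.le
    have h2 : (multisetSum fun v : {v // v ∉ S} => w v) ^ 2 ≤ ZK s := by
      refine le_trans ?_ (multisetSum_le_of_injective hf _)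
      refine le_trans (le_of_eq ?_) (multisetSum_mul_le _)
      rw [sq]
      congr 2 <;> ext v <;> simp [w, hl, hr]
    have h3 : (ZF s) ^ 2 ≤ (2 ^ S.card) ^ 2 * ZK s := by
      calc (ZF s) ^ 2 ≤ (2 ^ S.card * multisetSum fun v : {v // v ∉ S} => w v) ^ 2 := by gcongr
        _ ≤ _ := by rw [mul_pow]; gcongr
    have h4 := ENNReal.toReal_mono (by finiteness) h3
    rw [ENNReal.toReal_mul, ENNReal.toReal_pow, ENNReal.toReal_pow, ENNReal.toReal_pow] at h4
    have h5 := mul_le_mul_of_nonneg_left h4 (sq_nonneg (s - 1))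
    calc _ = (s - 1) ^ 2 * (ZF s).toReal ^ 2 := by ring
      _ ≤ _ := h5
      _ = _ := by rw [ENNReal.toReal_ofNat]; ring
  have hid : Tendsto (fun s : ℝ => s - 1) (𝓝[>] 1) (𝓝 0) := by
    have : Tendsto (fun s : ℝ => s - 1) (𝓝 1) (𝓝 (1 - 1)) := tendsto_id.sub_const 1
    rw [sub_self] at this
    exact this.mono_left nhdsWithin_le_nhds
  have := le_of_tendsto_of_tendsto (hlF.pow 2) ((hid.mul hlK).const_mul _) hle
  rw [zero_mul, mul_zero] at this
  exact absurd this (not_le.mpr (pow_pos (dedekindZeta_residue_pos F) 2))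
open scoped Pointwise

/-- A cyclic extension of number fields of prime degree has a prime that is inert, or at least
that is stable under the Galois group and unramified. -/
theorem NumberField.exists_smul_eq_self_and_notMem_sq (F K : Type*) [Field F] [NumberField F]
    [Field K] [NumberField K] [Algebra F K] [IsGalois F K] {p : ℕ} (hp : p.Prime)
    (hdeg : Module.finrank F K = p) :
    ∃ P : HeightOneSpectrum (𝓞 K), (∀ σ : Gal(K/F), σ • P.asIdeal = P.asIdeal) ∧
      ∃ b : 𝓞 F, algebraMap (𝓞 F) (𝓞 K) b ∈ P.asIdeal ∧
        algebraMap (𝓞 F) (𝓞 K) b ∉ P.asIdeal ^ 2 := by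
  by_contra! hcon
  have hdiff : differentIdeal (𝓞 F) (𝓞 K) ≠ ⊥ := differentIdeal_ne_bot
  have hfin : {v : HeightOneSpectrum (𝓞 F) | ∃ P : HeightOneSpectrum (𝓞 K),
      P.asIdeal ∣ differentIdeal (𝓞 F) (𝓞 K) ∧ P.asIdeal.under (𝓞 F) = v.asIdeal}.Finite := by
    refine Set.Finite.of_finite_image (f := HeightOneSpectrum.asIdeal) ?_
      fun v _ w _ h => HeightOneSpectrum.ext h
    refine ((Ideal.finite_factors hdiff).image
      fun P : HeightOneSpectrum (𝓞 K) => P.asIdeal.under (𝓞 F)).subset ?_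
    rintro _ ⟨v, ⟨P, hP, hPv⟩, rfl⟩
    exact ⟨P, hP, hPv⟩
  have key : ∀ v : HeightOneSpectrum (𝓞 F), v ∉ hfin.toFinset →
      ∃ P Q : HeightOneSpectrum (𝓞 K), P ≠ Q ∧ P.asIdeal.under (𝓞 F) = v.asIdeal ∧
        Q.asIdeal.under (𝓞 F) = v.asIdeal ∧
        Ideal.absNorm P.asIdeal = Ideal.absNorm v.asIdeal ∧
        Ideal.absNorm Q.asIdeal = Ideal.absNorm v.asIdeal := by
    intro v hv
    have := v.isPrime
    have hmax : v.asIdeal.IsMaximal := v.isMaximal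
    have hefg := Ideal.ncard_primesOver_mul_ramificationIdxIn_mul_inertiaDegIn v.asIdeal (𝓞 K)
      Gal(K/F)
    rw [IsGalois.card_aut_eq_finrank, hdeg] at hefg
    have hht : ∀ P ∈ v.asIdeal.primesOver (𝓞 K), ∃ P' : HeightOneSpectrum (𝓞 K),
        P'.asIdeal = P ∧ P'.asIdeal.under (𝓞 F) = v.asIdeal := by
      rintro P ⟨hP, hPv⟩
      exact ⟨⟨P, hP, Ideal.ne_bot_of_liesOver_of_ne_bot v.ne_bot P⟩, rfl, hPv.over.symm⟩
    by_cases hg : (v.asIdeal.primesOver (𝓞 K)).ncard = 1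
    · obtain ⟨P, hP⟩ := Set.ncard_eq_one.mp hg
      obtain ⟨P', rfl, hP'⟩ := hht P (hP ▸ Set.mem_singleton P)
      exfalso
      refine hv (hfin.mem_toFinset.mpr ⟨P', ?_, hP'⟩)
      have hlies : P'.asIdeal.LiesOver v.asIdeal := ⟨hP'.symm⟩
      have h2 := hcon P' fun σ => by
        have : σ • P'.asIdeal ∈ v.asIdeal.primesOver (𝓞 K) := by
          have := P'.isPrime
          exact ⟨inferInstance, inferInstance⟩
        rw [hP] at this
        exact this
      have h3 := pow_sub_one_dvd_differentIdeal (𝓞 F) P'.asIdeal 2 v.ne_bot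
        (Ideal.dvd_iff_le.mpr (Ideal.map_le_iff_le_comap.mpr fun b hb => h2 b ?_))
      · simpa using h3
      · rw [← hP'] at hb
        exact hb
    · have hgp : (v.asIdeal.primesOver (𝓞 K)).ncard = p :=
        ((Nat.dvd_prime hp).mp (Dvd.intro _ hefg)).resolve_left hg
      rw [hgp] at hefg
      have hef : v.asIdeal.ramificationIdxIn (𝓞 K) * v.asIdeal.inertiaDegIn (𝓞 K) = 1 :=
        Nat.eq_of_mul_eq_mul_left hp.pos (hefg.trans (mul_one p).symm)
      have hf := Nat.eq_one_of_mul_eq_one_left hef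
      have hnorm : ∀ P : HeightOneSpectrum (𝓞 K), P.asIdeal.under (𝓞 F) = v.asIdeal →
          Ideal.absNorm P.asIdeal = Ideal.absNorm v.asIdeal := by
        intro P hP
        have := P.isPrime
        have hlies : P.asIdeal.LiesOver v.asIdeal := ⟨hP.symm⟩
        have h1 := Ideal.absNorm_pow_inertiaDeg v.asIdeal P.asIdeal
        rw [← Ideal.inertiaDegIn_eq_inertiaDeg v.asIdeal P.asIdeal Gal(K/F), hf, pow_one] at h1
        exact h1.symm
      obtain ⟨P, Q, hP, hQ, hPQ⟩ := (Set.one_lt_ncard_iff (Set.finite_of_ncard_pos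
        (hgp ▸ hp.pos))).mp (hgp ▸ hp.one_lt)
      obtain ⟨P', rfl, hP'⟩ := hht P hP
      obtain ⟨Q', rfl, hQ'⟩ := hht Q hQ
      exact ⟨P', Q', fun h => hPQ (congrArg _ h), hP', hQ', hnorm P' hP', hnorm Q' hQ'⟩
  choose P Q hPQ hP hQ hPN hQN using key
  refine not_exists_pair_of_primes F K hfin.toFinset
    (Sum.elim (fun v => P v.1 v.2) (fun v => Q v.1 v.2)) ?_ (fun v => hPN v.1 v.2)
    (fun v => hQN v.1 v.2)
  rintro (v | v) (w | w) h
  · simp only [Sum.elim_inl] at h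
    exact congrArg _ (Subtype.ext (HeightOneSpectrum.ext (by rw [← hP v.1 v.2, h, hP])))
  · simp only [Sum.elim_inl, Sum.elim_inr] at h
    have : v = w := Subtype.ext (HeightOneSpectrum.ext (by rw [← hP v.1 v.2, h, hQ]))
    exact (hPQ v.1 v.2 (this ▸ h)).elim
  · simp only [Sum.elim_inl, Sum.elim_inr] at h
    have : v = w := Subtype.ext (HeightOneSpectrum.ext (by rw [← hQ v.1 v.2, h, hP]))
    exact (hPQ v.1 v.2 (this ▸ h.symm)).elim
  · simp only [Sum.elim_inr] at h
    exact congrArg _ (Subtype.ext (HeightOneSpectrum.ext (by rw [← hQ v.1 v.2, h, hQ])))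

/-- In a cyclic extension `K / F` of number fields of prime degree `p`, some element of `F` is not
the product of a norm and a `p`-th power. -/
theorem NumberField.exists_ne_prod_mul_pow (F K : Type*) [Field F] [NumberField F]
    [Field K] [NumberField K] [Algebra F K] [IsGalois F K] {p : ℕ} (hp : p.Prime)
    (hdeg : Module.finrank F K = p) :
    ∃ b : F, b ≠ 0 ∧ ∀ (σ : Gal(K/F)) (c r : K),
      algebraMap F K b ≠ (∏ i ∈ Finset.range p, (σ ^ i) c) * r ^ p := by
  obtain ⟨P, hP, b, hb, hb2⟩ := exists_smul_eq_self_and_notMem_sq F K hp hdeg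
  have hint : ∀ (σ : Gal(K/F)) (x : 𝓞 K) (n : ℕ), x ∈ P.asIdeal ^ n → σ • x ∈ P.asIdeal ^ n := by
    intro σ x n hx
    have h1 := Ideal.mem_map_of_mem (MulSemiringAction.toRingHom Gal(K/F) (𝓞 K) σ) hx
    rw [Ideal.map_pow] at h1
    have h2 := hP σ
    rw [Ideal.pointwise_smul_def] at h2
    rw [h2] at h1
    exact h1
  have hint' : ∀ (σ : Gal(K/F)) (x : 𝓞 K), P.intValuation (σ • x) ≤ P.intValuation x := by
    intro σ x
    by_cases hx : x = 0
    · simp [hx]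
    rw [P.intValuation_if_neg hx]
    refine (P.intValuation_le_pow_iff_mem _ _).mpr (hint σ x _ ?_)
    exact (P.intValuation_le_pow_iff_mem _ _).mp (P.intValuation_if_neg hx).le
  have hint'' : ∀ (σ : Gal(K/F)) (x : 𝓞 K), P.intValuation (σ • x) = P.intValuation x :=
    fun σ x => le_antisymm (hint' σ x) (by simpa using hint' σ⁻¹ (σ • x))
  have hval : ∀ (σ : Gal(K/F)) (x : K), P.valuation K (σ x) = P.valuation K x := by
    intro σ x
    obtain ⟨a, d, hd, rfl⟩ := IsFractionRing.div_surjective (A := 𝓞 K) x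
    have h1 : ∀ a : 𝓞 K, σ (algebraMap (𝓞 K) K a) = algebraMap (𝓞 K) K (σ • a) := fun a => rfl
    rw [map_div₀, map_div₀, map_div₀, h1, h1]
    simp only [HeightOneSpectrum.valuation_of_algebraMap, hint'']
  have hvb : P.valuation K (algebraMap F K b) = WithZero.exp (-1 : ℤ) := by
    have h1 : algebraMap F K b = algebraMap (𝓞 K) K (algebraMap (𝓞 F) (𝓞 K) b) := by
      rw [← IsScalarTower.algebraMap_apply, ← IsScalarTower.algebraMap_apply]
    rw [h1, HeightOneSpectrum.valuation_of_algebraMap]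
    refine le_antisymm ?_ ?_
    · simpa using (P.intValuation_le_pow_iff_mem (algebraMap (𝓞 F) (𝓞 K) b) 1).mpr (by simpa using hb)
    · have h2 := mt (P.intValuation_le_pow_iff_mem (algebraMap (𝓞 F) (𝓞 K) b) 2).mp hb2
      have h3 : P.intValuation (algebraMap (𝓞 F) (𝓞 K) b) ≠ 0 := fun h => h2 (by rw [h]; exact zero_le)
      rw [not_le, ← WithZero.exp_log h3, WithZero.exp_lt_exp] at h2
      rw [← WithZero.exp_log h3, WithZero.exp_le_exp]
      push_cast at h2
      omega
  refine ⟨b, ?_, fun σ c r h => ?_⟩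
  · intro h
    rw [h, map_zero, map_zero] at hvb
    exact WithZero.exp_ne_zero hvb.symm
  · have hpow : ∀ i : ℕ, P.valuation K ((σ ^ i) c) = P.valuation K c := fun i => hval _ _
    have h1 := congrArg (P.valuation K) h
    rw [hvb, map_mul, map_prod, Finset.prod_congr rfl fun i _ => hpow i, Finset.prod_const,
      Finset.card_range, map_pow, ← mul_pow] at h1
    set x := P.valuation K c * P.valuation K r with hx
    have hx0 : x ≠ 0 := fun h0 => by
      rw [h0, zero_pow hp.ne_zero] at h1
      exact WithZero.exp_ne_zero h1
    rw [← WithZero.exp_log hx0, ← WithZero.exp_nsmul, WithZero.exp_inj, nsmul_eq_mul] at h1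
    have h2 : (p : ℤ) ∣ 1 := ⟨-WithZero.log x, by linear_combination -h1⟩
    exact hp.one_lt.ne' (by exact_mod_cast Int.eq_one_of_dvd_one (by positivity) h2)

end NormNonSurjectivity

section Characters

variable {E Ω : Type*} [Field E] [Field Ω] [Algebra E Ω]

theorem IsPrimitiveRoot.sq_of_pow_eq {M : Type*} [CommMonoid M] {p : ℕ} [hp : Fact p.Prime]
    {ζ r : M} (hζ : IsPrimitiveRoot ζ p) (hr : r ^ p = ζ) : IsPrimitiveRoot r (p ^ 2) := by
  rw [IsPrimitiveRoot.iff_orderOf]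
  refine orderOf_eq_prime_pow (n := 1) ?_ ?_
  · rw [pow_one, hr]
    exact hζ.ne_one hp.out.one_lt
  · rw [pow_succ, pow_one, pow_mul, hr, hζ.pow_eq_one]

theorem exists_eq_algebraMap_mul_of_pow_eq_pow {p : ℕ} [NeZero p] {ζ : E}
    (hζ : IsPrimitiveRoot ζ p) {x y : Ω} (hy : y ≠ 0) (h : x ^ p = y ^ p) :
    ∃ r : E, x = algebraMap E Ω r * y := by
  have h1 : (x / y) ^ p = 1 := by rw [div_pow, h, div_self (pow_ne_zero p hy)]
  obtain ⟨i, -, hi⟩ := (hζ.map_of_injective (algebraMap E Ω).injective).eq_pow_of_pow_eq_one h1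
  exact ⟨ζ ^ i, by rw [map_pow, hi, div_mul_cancel₀ _ hy]⟩

theorem exists_rootPow_of_pow_eq_algebraMap {n : ℕ} [NeZero n] {ω : Ω} (hω : IsPrimitiveRoot ω n)
    {A : Ω} (hA0 : A ≠ 0) {a : E} (hA : A ^ n = algebraMap E Ω a) :
    ∃ α : (Ω ≃ₐ[E] Ω) → ZMod n, ∀ g, g A = rootPow ω (α g) * A := by
  have h : ∀ g : Ω ≃ₐ[E] Ω, ∃ k : ZMod n, g A = rootPow ω k * A := fun g => by
    have h1 : (g A / A) ^ n = 1 := by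
      rw [div_pow, ← map_pow, hA, AlgEquiv.commutes, ← hA, div_self (pow_ne_zero n hA0)]
    obtain ⟨i, -, hi⟩ := hω.eq_pow_of_pow_eq_one h1
    exact ⟨i, by rw [rootPow_natCast hω.pow_eq_one, hi, div_mul_cancel₀ _ hA0]⟩
  exact ⟨fun g => (h g).choose, fun g => (h g).choose_spec⟩

theorem map_rootPow {R S : Type*} [Semiring R] [Semiring S] {n : ℕ} (f : R →+* S) (x : R)
    (k : ZMod n) : f (rootPow x k) = rootPow (f x) k := by
  simp [rootPow]

theorem rootPow_mul {R : Type*} [Monoid R] {n : ℕ} [NeZero n] {x : R} (hx : x ^ n = 1)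
    (k l : ZMod n) : rootPow x (k * l) = rootPow (rootPow x k) l := by
  have h := rootPow_pow hx k
  obtain ⟨a, rfl⟩ := ZMod.natCast_zmod_surjective k
  obtain ⟨b, rfl⟩ := ZMod.natCast_zmod_surjective l
  rw [rootPow_natCast h, ← Nat.cast_mul, rootPow_natCast hx, rootPow_natCast hx, pow_mul]

theorem rootPow_mulPrime {R : Type*} [Monoid R] {p : ℕ} [NeZero p] {Z ζ : R} (hZ : Z ^ p = ζ)
    (hζ : ζ ^ p = 1) (k : ZMod p) : rootPow Z (ZMod.mulPrime k) = rootPow ζ k := by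
  have hZ2 : Z ^ p ^ 2 = 1 := by rw [pow_two, pow_mul, hZ, hζ]
  obtain ⟨a, rfl⟩ := ZMod.natCast_zmod_surjective k
  rw [ZMod.mulPrime_natCast, ← Nat.cast_mul, rootPow_natCast hZ2, rootPow_natCast hζ, pow_mul, hZ]

/-- The Kummer character of a `p`-th root. -/
theorem exists_kummer_character {p : ℕ} [NeZero p] {ζ : E} (hζ : IsPrimitiveRoot ζ p)
    {A : Ω} (hA0 : A ≠ 0) {a : E} (hA : A ^ p = algebraMap E Ω a) :
    ∃ α : (Ω ≃ₐ[E] Ω) → ZMod p, (∀ g h, α (g * h) = α g + α h) ∧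
      (∀ g, g A = algebraMap E Ω (rootPow ζ (α g)) * A) ∧ ∀ g, α g = 0 ↔ g A = A := by
  have hω := hζ.map_of_injective (algebraMap E Ω).injective
  obtain ⟨α, hα⟩ := exists_rootPow_of_pow_eq_algebraMap hω hA0 hA
  simp_rw [← map_rootPow] at hα
  have hinj : ∀ k l : ZMod p, algebraMap E Ω (rootPow ζ k) * A = algebraMap E Ω (rootPow ζ l) * A →
      k = l := fun k l h =>
    hζ.rootPow_injective ((algebraMap E Ω).injective (mul_right_cancel₀ hA0 h))
  refine ⟨α, fun g h => hinj _ _ ?_, hα, fun g => ⟨fun h => ?_, fun h => hinj _ _ ?_⟩⟩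
  · rw [← hα, AlgEquiv.mul_apply, hα h, map_mul, AlgEquiv.commutes, hα g,
      rootPow_add hζ.pow_eq_one, map_mul]
    ring
  · rw [hα, h, rootPow_zero, map_one, one_mul]
  · rw [← hα, h, rootPow_zero, map_one, one_mul]

/-- The Kummer cocycle of a `p²`-th root, in terms of the character `κ` describing the action
on a primitive `p²`-th root of unity `Z`. -/
theorem exists_kummer_cocycle {p : ℕ} [Fact p.Prime] {ζ : E} (hζ : IsPrimitiveRoot ζ p) {Z : Ω}
    (hZ : Z ^ p = algebraMap E Ω ζ) {κ : (Ω ≃ₐ[E] Ω) → ZMod p}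
    (hκ : ∀ g, g Z = algebraMap E Ω (rootPow ζ (κ g)) * Z) {A : Ω} (hA0 : A ≠ 0) {a : E}
    (hA : A ^ p ^ 2 = algebraMap E Ω a) {α : (Ω ≃ₐ[E] Ω) → ZMod p}
    (hα : ∀ g, g (A ^ p) = algebraMap E Ω (rootPow ζ (α g)) * A ^ p) :
    ∃ X : (Ω ≃ₐ[E] Ω) → ZMod (p ^ 2),
      (∀ g h, X (g * h) = X g + (1 + ZMod.mulPrime (κ g)) * X h) ∧
      (∀ g, ZMod.reduction p (X g) = α g) ∧ ∀ g, g A = A → X g = 0 := by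
  have hζ' := hζ.map_of_injective (algebraMap E Ω).injective
  have hZp := hζ'.sq_of_pow_eq hZ
  obtain ⟨X, hX⟩ := exists_rootPow_of_pow_eq_algebraMap hZp hA0 hA
  have hZ1 := hZp.pow_eq_one
  have hgZ : ∀ g : Ω ≃ₐ[E] Ω, g Z = rootPow Z (1 + ZMod.mulPrime (κ g)) := fun g => by
    have h1 : rootPow Z (1 : ZMod (p ^ 2)) = Z := by
      rw [← Nat.cast_one, rootPow_natCast hZ1, pow_one]
    rw [rootPow_add hZ1, rootPow_mulPrime hZ hζ'.pow_eq_one, h1, hκ, ← map_rootPow, mul_comm]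
  have hinj : ∀ k l : ZMod (p ^ 2), rootPow Z k * A = rootPow Z l * A → k = l := fun k l h =>
    hZp.rootPow_injective (mul_right_cancel₀ hA0 h)
  refine ⟨X, fun g h => hinj _ _ ?_, fun g => ?_, fun g h => hinj _ _ ?_⟩
  · have h2 : g (rootPow Z (X h)) = rootPow (g Z) (X h) := map_rootPow (g : Ω →+* Ω) Z (X h)
    rw [← hX, AlgEquiv.mul_apply, hX h, map_mul, h2, hX g, hgZ, ← rootPow_mul hZ1,
      rootPow_add hZ1]
    ring
  · have h3 := hα g
    rw [map_pow, hX, mul_pow, map_rootPow] at h3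
    apply hζ'.rootPow_injective
    rw [← mul_right_cancel₀ (pow_ne_zero p hA0) h3]
    obtain ⟨x, hx⟩ := ZMod.natCast_zmod_surjective (X g)
    rw [← hx, map_natCast, rootPow_natCast hζ'.pow_eq_one, rootPow_natCast hZ1, ← pow_mul,
      mul_comm, pow_mul, hZ]
  · rw [← hX, h, rootPow_zero, one_mul]

theorem apply_inv_of_additive {G A : Type*} [Group G] [AddCommGroup A] {χ : G → A}
    (hχ : ∀ g h, χ (g * h) = χ g + χ h) (g : G) : χ g⁻¹ = -χ g := by
  have h1 : χ 1 = 0 := by simpa using hχ 1 1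
  have h2 := hχ g⁻¹ g
  rw [inv_mul_cancel, h1] at h2
  exact eq_neg_of_add_eq_zero_left h2.symm

theorem exists_subgroup_mem_iff {G A : Type*} [Group G] [AddCommGroup A] {χ : G → A}
    (hχ : ∀ g h, χ (g * h) = χ g + χ h) : ∃ H : Subgroup G, ∀ g, g ∈ H ↔ χ g = 0 :=
  ⟨{ carrier := {g | χ g = 0}
     mul_mem' := fun {g h} hg hh => (hχ g h).trans (by
       rw [show χ g = 0 from hg, show χ h = 0 from hh, add_zero])
     one_mem' := by simpa using hχ 1 1
     inv_mem' := fun {g} hg => (apply_inv_of_additive hχ g).trans (by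
       rw [show χ g = 0 from hg, neg_zero]) }, fun _ => Iff.rfl⟩

theorem exists_mem_eq_one {G : Type*} [Group G] {p : ℕ} [Fact p.Prime] {χ : G → ZMod p}
    (hχ : ∀ g h, χ (g * h) = χ g + χ h) (H : Subgroup G) {g : G} (hg : g ∈ H) (h : χ g ≠ 0) :
    ∃ σ ∈ H, χ σ = 1 := by
  let f : G →* Multiplicative (ZMod p) := ⟨⟨fun g => .ofAdd (χ g), by
    have := hχ 1 1
    rw [mul_one, left_eq_add] at this
    rw [this]; rfl⟩, fun g h => congrArg Multiplicative.ofAdd (hχ g h)⟩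
  refine ⟨g ^ ((χ g)⁻¹).val, H.pow_mem hg _, ?_⟩
  have h1 : χ (g ^ ((χ g)⁻¹).val) = ((χ g)⁻¹).val • χ g :=
    congrArg Multiplicative.toAdd (map_pow f g ((χ g)⁻¹).val)
  rw [h1, nsmul_eq_mul, ZMod.natCast_zmod_val, inv_mul_cancel₀ h]

theorem exists_map_eq_of_fixed [IsGalois E Ω] {M : Type*} [Field M] (j : M →+* Ω)
    (hE : ∀ f, ∃ m, j m = algebraMap E Ω f) (s : Set Ω) (hs : ∀ x ∈ s, ∃ m, j m = x) {z : Ω}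
    (hz : ∀ g : Ω ≃ₐ[E] Ω, (∀ x ∈ s, g x = x) → g z = z) : ∃ m, j m = z := by
  let R : IntermediateField E Ω := j.fieldRange.toIntermediateField hE
  have hle : IntermediateField.adjoin E s ≤ R := IntermediateField.adjoin_le_iff.mpr hs
  apply hle
  rw [← InfiniteGalois.fixedField_fixingSubgroup (IntermediateField.adjoin E s)]
  rintro ⟨g, hg⟩
  exact hz g fun x hx => hg ⟨x, IntermediateField.subset_adjoin E s hx⟩

theorem exists_algEquiv_of_agree {F K : Type*} [Field F] [Field K] [Algebra F K] [Normal F K]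
    (φ ψ : K →+* Ω) (h : ∀ c : F, φ (algebraMap F K c) = ψ (algebraMap F K c)) :
    ∃ σ : K ≃ₐ[F] K, ∀ x, ψ x = φ (σ x) := by
  let _ := φ.toAlgebra
  let _ := (φ.comp (algebraMap F K)).toAlgebra
  have : IsScalarTower F K Ω := IsScalarTower.of_algebraMap_eq fun _ => rfl
  let ψ' : K →ₐ[F] Ω := { ψ with commutes' := fun c => (h c).symm }
  exact ⟨Normal.algHomEquivAut F Ω K ψ', fun x =>
    (DFunLike.congr_fun ((Normal.algHomEquivAut F Ω K).symm_apply_apply ψ') x).symm⟩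

end Characters

section LaurentSeries

open HahnSeries in
/-- Over `F((T))`, a character whose cup product with the Kummer character `t` of a uniformizer
vanishes is trivial on the kernel of `t`. -/
theorem LaurentSeries.eq_zero_of_cup_eq_zero {F : Type} [Field F] [CharZero F] {p : ℕ}
    [Fact p.Prime] (hodd : p ≠ 2) {ζ : LaurentSeries F} (hζ : IsPrimitiveRoot ζ p)
    {j : LaurentSeries F →+* SeparableClosure (LaurentSeries F)}
    (hjC : ∀ c : F, j (C c) = algebraMap (LaurentSeries F) _ (C c))
    (hjE : ∀ f, ∃ f', j f' = algebraMap (LaurentSeries F) _ f)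
    {t e y : AbsGal (LaurentSeries F) → ZMod p} (htadd : ∀ g h, t (g * h) = t g + t h)
    (ht : ∀ g, g (j (single 1 1)) = algebraMap _ _ (rootPow ζ (t g)) * j (single 1 1))
    (htfix : ∀ g, t g = 0 → ∀ f, g (j f) = j f)
    {τ : AbsGal (LaurentSeries F)} (hτ : t τ = 1)
    (L : IntermediateField (LaurentSeries F) (SeparableClosure (LaurentSeries F)))
    [FiniteDimensional (LaurentSeries F) L]
    (he : ∀ g h, e (g * h) = e g + e h) (hy : ∀ g h, y (g * h) = y g + y h + e g * t h)
    (heL : ∀ g ∈ L.fixingSubgroup, e g = 0) (hyL : ∀ g ∈ L.fixingSubgroup, y g = 0)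
    (g : AbsGal (LaurentSeries F)) (hg : t g = 0) : e g = 0 := by
  have hp0 : p ≠ 0 := NeZero.ne p
  have hζ1 := hζ.pow_eq_one
  have ht1 : t 1 = 0 := by simpa using htadd 1 1
  have hj0 : j (single 1 1) ≠ 0 := (map_ne_zero j).mpr (by simp)
  have hfixt : ∀ g, g (j (single 1 1)) = j (single 1 1) → t g = 0 := fun g hg => by
    rw [ht] at hg
    apply hζ.rootPow_injective
    apply (algebraMap (LaurentSeries F) (SeparableClosure (LaurentSeries F))).injective
    apply mul_right_cancel₀ hj0
    rw [hg, rootPow_zero, map_one (algebraMap _ _), one_mul]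
  obtain ⟨η, hη0, hη⟩ := exists_kummer_generator hζ1 ⊤ L e (fun g _ h _ => he g h)
    (fun g _ => heL g)
  obtain ⟨z, hz, hzη⟩ := exists_norm_eq_of_cup_eq_zero hodd hζ1 ⊤ L e t y
    (fun g _ h _ => htadd g h) (fun g _ h _ => hy g h) (fun g _ => hyL g) hη
    (Subgroup.mem_top τ) hτ
  obtain ⟨f, rfl⟩ := exists_map_eq_of_fixed j hjE {j (single 1 1)}
    (by rintro _ rfl; exact ⟨_, rfl⟩)
    (fun g hg => hz g (Subgroup.mem_top g) (hfixt g (hg _ rfl)))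
  have hf0 : f ≠ 0 := by
    rintro rfl
    simp only [map_zero] at hzη
    rw [Finset.prod_eq_zero (Finset.mem_range.mpr (Nat.pos_of_ne_zero hp0)) rfl] at hzη
    exact pow_ne_zero p hη0 hzη.symm
  obtain ⟨c, k, u, -, rfl⟩ := exists_eq_C_mul_single_mul_pow hp0 f hf0
  set v := j (C c) * j (single 1 1) ^ k * ∏ i ∈ Finset.range p, (τ ^ i) (j u) with hv
  have hτC : ∀ i : ℕ, (τ ^ i) (j (C c)) = j (C c) := fun i => by
    rw [hjC, AlgEquiv.commutes]
  have hkp : (j (single 1 1) ^ p) ^ k = (j (single 1 1) ^ k) ^ p := by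
    rw [← zpow_natCast, ← zpow_natCast, zpow_comm]
  have hvη : η ^ p = v ^ p := by
    rw [← hzη, hv]
    simp only [map_mul, map_pow, map_zpow₀, hτC, Finset.prod_mul_distrib, Finset.prod_pow,
      Finset.prod_zpow, Finset.prod_const, Finset.card_range, mul_pow,
      prod_pow_apply_eq_pow hodd hζ1 (ht τ), hkp]
  have hv0 : v ≠ 0 := fun h => by
    rw [h, zero_pow hp0] at hvη
    exact pow_ne_zero p hη0 hvη
  obtain ⟨r, hr⟩ := exists_eq_algebraMap_mul_of_pow_eq_pow hζ hv0 hvη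
  have hgv : g v = v := by
    have hgτ : ∀ i : ℕ, g ((τ ^ i) (j u)) = (τ ^ i) (j u) := fun i => by
      have h1 := htfix ((τ ^ i)⁻¹ * g * τ ^ i) (by
        have h2 := htadd (τ ^ i)⁻¹ (τ ^ i)
        rw [inv_mul_cancel, ht1] at h2
        rw [htadd, htadd, hg, add_zero, ← h2]) u
      rw [AlgEquiv.mul_apply, AlgEquiv.mul_apply] at h1
      exact (AlgEquiv.symm_apply_eq _).mp h1
    rw [hv, map_mul, map_mul, map_zpow₀, map_prod, htfix g hg, htfix g hg]
    simp_rw [hgτ]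
  have hgη : g η = η := by rw [hr, map_mul, AlgEquiv.commutes, hgv]
  rw [hη g (Subgroup.mem_top g)] at hgη
  apply hζ.rootPow_injective
  apply (algebraMap (LaurentSeries F) (SeparableClosure (LaurentSeries F))).injective
  apply mul_right_cancel₀ hη0
  rw [hgη, rootPow_zero, map_one (algebraMap _ _), one_mul]

open HahnSeries in
/-- If the cup product of the Kummer characters of `b ∈ F` and of a generator `ξ` of `K` vanishes
over `F((T^{1/p}))`, then `b` is a norm from `K` up to `p`-th powers in `K`. -/
theorem LaurentSeries.exists_eq_prod_mul_pow_of_cup_eq_zero {F K : Type} [Field F] [CharZero F]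
    [Field K] [CharZero K] [Algebra F K] [FiniteDimensional F K] [Normal F K] {p : ℕ}
    [Fact p.Prime] (hodd : p ≠ 2) {ζ : LaurentSeries F} (hζ : IsPrimitiveRoot ζ p)
    {j : LaurentSeries K →+* SeparableClosure (LaurentSeries F)}
    (hjC : ∀ c : F, j (C (algebraMap F K c)) = algebraMap (LaurentSeries F) _ (C c))
    (hjE : ∀ f, ∃ f', j f' = algebraMap (LaurentSeries F) _ f)
    {t κ β y : AbsGal (LaurentSeries F) → ZMod p} (htadd : ∀ g h, t (g * h) = t g + t h)
    (ht : ∀ g, t g = 0 ↔ g (j (single 1 1)) = j (single 1 1))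
    {ξ : K} (hκadd : ∀ g h, κ (g * h) = κ g + κ h) (hκ : ∀ g, κ g = 0 ↔ g (j (C ξ)) = j (C ξ))
    (hfix : ∀ g, t g = 0 → κ g = 0 → ∀ f, g (j f) = j f)
    {b : F} (hb : b ≠ 0) {B : SeparableClosure (LaurentSeries F)}
    (hB : B ^ p = algebraMap (LaurentSeries F) _ (C b))
    (hβ : ∀ g, g B = algebraMap _ _ (rootPow ζ (β g)) * B)
    {σ₀ : AbsGal (LaurentSeries F)} (htσ : t σ₀ = 0) (hκσ : κ σ₀ = 1)
    (L : IntermediateField (LaurentSeries F) (SeparableClosure (LaurentSeries F)))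
    [FiniteDimensional (LaurentSeries F) L]
    (hy : ∀ g h, t g = 0 → t h = 0 → y (g * h) = y g + y h + β g * κ h)
    (hyL : ∀ g ∈ L.fixingSubgroup, t g = 0 → y g = 0) :
    ∃ (σ : K ≃ₐ[F] K) (c r : K),
      algebraMap F K b = (∏ i ∈ Finset.range p, (σ ^ i) c) * r ^ p := by
  have hp0 : p ≠ 0 := NeZero.ne p
  have hζ1 := hζ.pow_eq_one
  have hB0 : B ≠ 0 := fun h => by
    rw [h, zero_pow hp0, eq_comm, map_eq_zero, map_eq_zero] at hB
    exact hb hB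
  obtain ⟨H, hH⟩ := exists_subgroup_mem_iff htadd
  obtain ⟨z, hz, hzB⟩ := exists_norm_eq_of_cup_eq_zero hodd hζ1 H L β κ y
    (fun g _ h _ => hκadd g h) (fun g hg h hh => hy g h ((hH g).mp hg) ((hH h).mp hh))
    (fun g hg hgL => hyL g hgL ((hH g).mp hg))
    (fun g _ => hβ g) (σ := σ₀) ((hH σ₀).mpr htσ) hκσ
  obtain ⟨f, rfl⟩ := exists_map_eq_of_fixed j hjE {j (single 1 1), j (C ξ)}
    (by rintro _ (rfl | rfl) <;> exact ⟨_, rfl⟩)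
    (fun g hg => hz g ((hH g).mpr ((ht g).mpr (hg _ (Or.inl rfl))))
       ((hκ g).mpr (hg _ (Or.inr rfl))))
  have hf0 : f ≠ 0 := by
    rintro rfl
    simp only [map_zero] at hzB
    rw [Finset.prod_eq_zero (Finset.mem_range.mpr (Nat.pos_of_ne_zero hp0)) rfl] at hzB
    exact pow_ne_zero p hB0 hzB.symm
  obtain ⟨c, k, u, hc, rfl⟩ := exists_eq_C_mul_single_mul_pow hp0 f hf0
  obtain ⟨σ, hσ⟩ := exists_algEquiv_of_agree (j.comp (C : K →+* LaurentSeries K))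
    ((σ₀ : SeparableClosure (LaurentSeries F) →+* _).comp (j.comp C)) (F := F) (fun c => by
      change j (C (algebraMap F K c)) = σ₀ (j (C (algebraMap F K c)))
      rw [hjC, AlgEquiv.commutes])
  replace hσ : ∀ x, σ₀ (j (C x)) = j (C (σ x)) := hσ
  have hσi : ∀ i : ℕ, (σ₀ ^ i) (j (C c)) = j (C ((σ ^ i) c)) := fun i => by
    induction i with
    | zero => rfl
    | succ i ih => rw [pow_succ', pow_succ', AlgEquiv.mul_apply, AlgEquiv.mul_apply, ih, hσ]
  have hS : ∀ i : ℕ, (σ₀ ^ i) (j (single 1 1)) = j (single 1 1) := fun i =>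
    (ht _).mp ((hH _).mp (H.pow_mem ((hH σ₀).mpr htσ) i))
  obtain ⟨w, hw⟩ := exists_map_eq_of_fixed j hjE {j (single 1 1), j (C ξ)}
    (by rintro _ (rfl | rfl) <;> exact ⟨_, rfl⟩) (z := ∏ i ∈ Finset.range p, (σ₀ ^ i) (j u))
    (fun g hg => by
      have htg := (ht g).mpr (hg _ (Or.inl rfl))
      have hκg := (hκ g).mpr (hg _ (Or.inr rfl))
      rw [map_prod]
      refine Finset.prod_congr rfl fun i _ => ?_
      have h1 := hfix ((σ₀ ^ i)⁻¹ * g * σ₀ ^ i)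
        (by rw [htadd, htadd, apply_inv_of_additive htadd, htg]; ring)
        (by rw [hκadd, hκadd, apply_inv_of_additive hκadd, hκg]; ring) u
      rw [AlgEquiv.mul_apply, AlgEquiv.mul_apply] at h1
      exact (AlgEquiv.symm_apply_eq _).mp h1)
  have hN : ∏ i ∈ Finset.range p, (σ ^ i) c ≠ 0 :=
    Finset.prod_ne_zero_iff.mpr fun i _ => (map_ne_zero (σ ^ i)).mpr hc
  have hmain : C (algebraMap F K b) =
      C (∏ i ∈ Finset.range p, (σ ^ i) c) * (single 1 1 ^ k * w) ^ p := by
    apply j.injective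
    rw [hjC, ← hB, ← hzB]
    simp only [map_mul, map_pow, map_zpow₀, hσi, hS, hw, map_prod, Finset.prod_mul_distrib,
      Finset.prod_pow, Finset.prod_const, Finset.card_range, mul_pow, mul_assoc]
  obtain ⟨r, hr⟩ := exists_eq_C_of_pow_eq_C
    (d := algebraMap F K b / ∏ i ∈ Finset.range p, (σ ^ i) c) (v := single 1 1 ^ k * w) (n := p) (by
      have hCN := (map_ne_zero (C : K →+* LaurentSeries K)).mpr hN
      rw [map_div₀, hmain, mul_div_cancel_left₀ _ hCN])
  exact ⟨σ, c, r, by rw [hr, mul_div_cancel₀ _ hN]⟩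

end LaurentSeries

section Main

open Polynomial in
/-- The extension of a number field obtained by adjoining a `p`-th root of a primitive `p`-th root
of unity. -/
theorem NumberField.exists_isGalois_root {p : ℕ} (hp : p.Prime) {F : Type} [Field F]
    [NumberField F] {ζ : F} (hζ : IsPrimitiveRoot ζ p) (hζp : ∀ r : F, r ^ p ≠ ζ) :
    ∃ (K : Type) (_ : Field K) (_ : NumberField K) (_ : Algebra F K),
      IsGalois F K ∧ Module.finrank F K = p ∧ ∃ ξ : K, ξ ^ p = algebraMap F K ζ ∧
        ∀ σ : K ≃ₐ[F] K, σ ξ = ξ → σ = 1 := by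
  have hirr := X_pow_sub_C_irreducible_of_prime hp hζp
  have hroots : (primitiveRoots p F).Nonempty := ⟨ζ, (mem_primitiveRoots hp.pos).mpr hζ⟩
  have : Fact (Irreducible (X ^ p - C ζ)) := ⟨hirr⟩
  have := isSplittingField_AdjoinRoot_X_pow_sub_C hroots hirr
  have : Module.Finite F (AdjoinRoot (X ^ p - C ζ)) :=
    (AdjoinRoot.powerBasis hirr.ne_zero).finite
  refine ⟨AdjoinRoot (X ^ p - C ζ), inferInstance, NumberField.of_module_finite F _, inferInstance,
    isGalois_of_isSplittingField_X_pow_sub_C hroots hirr _,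
    finrank_of_isSplittingField_X_pow_sub_C hroots hirr _, AdjoinRoot.root _, ?_, fun σ hσ => ?_⟩
  · have h := AdjoinRoot.eval₂_root (X ^ p - C ζ)
    rwa [eval₂_sub, eval₂_X_pow, eval₂_C, sub_eq_zero] at h
  · have h : (σ : _ →ₐ[F] AdjoinRoot (X ^ p - C ζ)) = AlgHom.id F _ := AdjoinRoot.algHom_ext hσ
    exact AlgEquiv.ext fun x => DFunLike.congr_fun h x

theorem exists_unitriangular_of_characters {G : Type*} [Group G] {p : ℕ} [Fact p.Prime]
    (hodd : p ≠ 2) {t β : G → ZMod p} (ht : ∀ g h, t (g * h) = t g + t h)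
    (hβ : ∀ g h, β (g * h) = β g + β h) :
    ∃ ρ : G →* GL (Fin 3) (ZMod p),
      (∀ g, (ρ g).val = !![1, t g, t g ^ 2 * 2⁻¹ + β g; 0, 1, t g; 0, 0, 1]) ∧
      ∀ g, IsUpperTri (ρ g) := by
  have h2 : (2 : ZMod p) ≠ 0 := by
    have := (ZMod.natCast_eq_zero_iff 2 p).not.mpr fun h =>
      hodd ((Nat.prime_dvd_prime_iff_eq Fact.out Nat.prime_two).mp h)
    exact_mod_cast this
  have ht1 : t 1 = 0 := by simpa using ht 1 1
  have hβ1 : β 1 = 0 := by simpa using hβ 1 1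
  let M : G →* Matrix (Fin 3) (Fin 3) (ZMod p) :=
    { toFun := fun g => !![1, t g, t g ^ 2 * 2⁻¹ + β g; 0, 1, t g; 0, 0, 1]
      map_one' := by
        rw [ht1, hβ1, Matrix.one_fin_three]
        simp
      map_mul' := fun g h => by
        rw [ht, hβ]
        have h02 : (t g + t h) ^ 2 * 2⁻¹ + (β g + β h) =
            t h ^ 2 * 2⁻¹ + β h + t g * t h + (t g ^ 2 * 2⁻¹ + β g) := by
          linear_combination (t g * t h) * mul_inv_cancel₀ h2
        simp only [Matrix.mul_fin_three, mul_zero, mul_one, one_mul, add_zero, zero_mul, zero_add]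
        rw [h02, add_comm (t g)] }
  refine ⟨M.toHomUnits, MonoidHom.coe_toHomUnits M, fun g i j hij => ?_⟩
  rw [MonoidHom.coe_toHomUnits]
  fin_cases i <;> fin_cases j <;> first | rfl | exact absurd hij (by decide)

theorem LaurentSeries.single_ne_pow {F : Type*} [Field F] {n : ℕ} (hn : 1 < n)
    (f : LaurentSeries F) : f ^ n ≠ HahnSeries.single 1 1 := fun h => by
  have h1 := congrArg HahnSeries.order h
  rw [HahnSeries.order_pow, HahnSeries.order_single one_ne_zero, nsmul_eq_mul] at h1
  have h2 := Int.isUnit_iff.mp (IsUnit.of_mul_eq_one _ h1)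
  omega

end Main

open HahnSeries in
theorem stmt_9 (p : ℕ) [Fact p.Prime] (hodd : p ≠ 2)
    (F : Type) [Field F] [NumberField F]
    (ζ : F) (hζ : IsPrimitiveRoot ζ p)
    (hno : ¬ ∃ ξ : F, IsPrimitiveRoot ξ (p ^ 2)) :
    ∃ ρ : AbsGal (LaurentSeries F) →* GL (Fin 3) (ZMod p),
      IsOpen (ρ.ker : Set (AbsGal (LaurentSeries F))) ∧ (∀ g, IsUpperTri (ρ g)) ∧
      ¬ ∃ ρ₂ : AbsGal (LaurentSeries F) →* GL (Fin 3) (ZMod (p ^ 2)),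
          IsOpen (ρ₂.ker : Set (AbsGal (LaurentSeries F))) ∧ (∀ g, IsUpperTri (ρ₂ g)) ∧
          (Matrix.GeneralLinearGroup.map
            (ZMod.castHom (dvd_pow_self p two_ne_zero) (ZMod p))).comp ρ₂ = ρ := by
  have hp : p.Prime := Fact.out
  have hp0 : p ≠ 0 := hp.ne_zero
  have hζp : ∀ r : F, r ^ p ≠ ζ := fun r hr => hno ⟨r, hζ.sq_of_pow_eq hr⟩
  obtain ⟨K, _, _, _, _, hdeg, ξ, hξ, hξσ⟩ := NumberField.exists_isGalois_root hp hζ hζp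
  obtain ⟨b, hb0, hb⟩ := NumberField.exists_ne_prod_mul_pow F K hp hdeg
  obtain ⟨jF, hFC, hFS, hFE, hFfix⟩ := LaurentSeries.exists_embedding F F p hp0
  obtain ⟨jK, hKC, hKS, hKE, hKfix⟩ := LaurentSeries.exists_embedding F K p hp0
  replace hFC : ∀ c : F, jF (C c) = algebraMap (LaurentSeries F) _ (C c) := fun c => hFC c
  let E := LaurentSeries F
  let Ω := SeparableClosure E
  have hroot : ∀ x : Ω, ∃ z, z ^ p = x := fun x => by
    have : NeZero (p : Ω) := ⟨by
      rw [← map_natCast (algebraMap E Ω), ← map_natCast (C : F →+* E)]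
      exact (map_ne_zero _).mpr ((map_ne_zero _).mpr (Nat.cast_ne_zero.mpr hp0))⟩
    exact IsSepClosed.exists_pow_nat_eq x p
  have hζE : IsPrimitiveRoot (C ζ : E) p := hζ.map_of_injective (C : F →+* E).injective
  have hj0 : jF (single 1 1) ≠ 0 := (map_ne_zero jF).mpr (by simp)
  have hZ : jK (C ξ) ^ p = algebraMap E Ω (C ζ) := by
    rw [← map_pow, ← map_pow, hξ, hKC]
  have hZ0 : jK (C ξ) ≠ 0 := fun h => by
    rw [h, zero_pow hp0, eq_comm, map_eq_zero, map_eq_zero] at hZ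
    exact hζ.ne_zero hp0 hZ
  obtain ⟨B, hB⟩ := hroot (algebraMap E Ω (C b))
  have hB0 : B ≠ 0 := fun h => by
    rw [h, zero_pow hp0, eq_comm, map_eq_zero, map_eq_zero] at hB
    exact hb0 hB
  obtain ⟨t, htadd, ht, ht0⟩ := exists_kummer_character hζE hj0 hFS
  obtain ⟨κ, hκadd, hκ, hκ0⟩ := exists_kummer_character hζE hZ0 hZ
  obtain ⟨β, hβadd, hβ, hβ0⟩ := exists_kummer_character hζE hB0 hB
  obtain ⟨ρ, hρ, hρU⟩ := exists_unitriangular_of_characters hodd htadd hβadd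
  have hint : ∀ x : Ω, IsIntegral E x := fun x => Algebra.IsIntegral.isIntegral x
  refine ⟨ρ, ?_, hρU, ?_⟩
  · let L : IntermediateField E Ω := IntermediateField.adjoin E {jF (single 1 1), B}
    have : FiniteDimensional E L := IntermediateField.finiteDimensional_adjoin fun x _ => hint x
    refine Subgroup.isOpen_mono (fun g hg => ?_) (IntermediateField.fixingSubgroup_isOpen L)
    rw [IntermediateField.mem_fixingSubgroup_iff] at hg
    have h1 := (ht0 g).mpr (hg _ (IntermediateField.subset_adjoin E _ (Or.inl rfl)))
    have h2 := (hβ0 g).mpr (hg _ (IntermediateField.subset_adjoin E _ (Or.inr rfl)))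
    rw [MonoidHom.mem_ker]
    apply Units.ext
    rw [hρ, h1, h2, Units.val_one, Matrix.one_fin_three]
    simp
  rintro ⟨ρ₂, hopen, hupper, hlift⟩
  have hred : ∀ g i j, ZMod.reduction p ((ρ₂ g).val i j) = (ρ g).val i j := fun g i j => by
    rw [← hlift]
    rfl
  obtain ⟨δ₁, δ₂, hδ₁, hδ₂, hδ, X₁, X₂, X₃, hX₁, hX₂, hX₃, hr₁, hr₂, hr₃, hX⟩ :=
    exists_cocycles_of_isUpperTri ρ₂ hupper (fun g i => by
      rw [hred, hρ]
      fin_cases i <;> rfl)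
  replace hr₁ : ∀ g, ZMod.reduction p (X₁ g) = t g := fun g => by
    rw [hr₁, hred, hρ]; rfl
  replace hr₂ : ∀ g, ZMod.reduction p (X₂ g) = t g := fun g => by
    rw [hr₂, hred, hρ]; rfl
  replace hr₃ : ∀ g, t g = 0 → ZMod.reduction p (X₃ g) = β g := fun g hg => by
    rw [hr₃, hred, hρ, hg]
    simp
  replace hX₃ : ∀ g h, t g = 0 → t h = 0 →
      X₃ (g * h) = X₃ g + (1 + ZMod.mulPrime (δ₁ g + δ₂ g)) * X₃ h := fun g h hg hh =>
    hX₃ g h (by rw [hred, hρ, hg]; rfl) (by rw [hred, hρ, hh]; rfl)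
  obtain ⟨T₂, hT₂⟩ := hroot (jF (single 1 1))
  obtain ⟨B₂, hB₂⟩ := hroot B
  obtain ⟨L₁, _, hL₁⟩ := (krullTopology_mem_nhds_one_iff E Ω _).mp
    (hopen.mem_nhds (one_mem ρ₂.ker))
  let L₂ : IntermediateField E Ω := IntermediateField.adjoin E {jK (C ξ), T₂, B₂}
  have : FiniteDimensional E L₂ := IntermediateField.finiteDimensional_adjoin fun x _ => hint x
  let L := L₁ ⊔ L₂
  have hL : ∀ g ∈ L.fixingSubgroup,
      ρ₂ g = 1 ∧ g (jK (C ξ)) = jK (C ξ) ∧ g T₂ = T₂ ∧ g B₂ = B₂ := fun g hg => by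
    rw [IntermediateField.mem_fixingSubgroup_iff] at hg
    have hg₂ : ∀ x ∈ ({jK (C ξ), T₂, B₂} : Set Ω), g x = x := fun x hx =>
      hg x ((le_sup_right : L₂ ≤ L) (IntermediateField.subset_adjoin E _ hx))
    exact ⟨hL₁ ((IntermediateField.mem_fixingSubgroup_iff _ _).mpr
      fun x hx => hg x ((le_sup_left : L₁ ≤ L) hx)), hg₂ _ (by simp), hg₂ _ (by simp),
      hg₂ _ (by simp)⟩
  have hT₂0 : T₂ ≠ 0 := by
    rintro rfl
    exact hj0 (by rw [← hT₂, zero_pow hp0])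
  have hB₂0 : B₂ ≠ 0 := by
    rintro rfl
    exact hB0 (by rw [← hB₂, zero_pow hp0])
  obtain ⟨XT, hXT, hXTt, hXT0⟩ := exists_kummer_cocycle hζE hZ hκ hT₂0
    (a := single 1 1) (by rw [pow_two, pow_mul, hT₂, hFS]) (by rw [hT₂]; exact ht)
  obtain ⟨XB, hXB, hXBβ, hXB0⟩ := exists_kummer_cocycle hζE hZ hκ hB₂0
    (a := C b) (by rw [pow_two, pow_mul, hB₂, hB]) (by rw [hB₂]; exact hβ)
  have hKC' : ∀ g : AbsGal E, g (jK (C ξ)) = jK (C ξ) → ∀ k, g (jK (C k)) = jK (C k) :=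
    fun g hg => by
      obtain ⟨σ, hσ⟩ := exists_algEquiv_of_agree (jK.comp (C : K →+* LaurentSeries K))
        ((g : Ω →+* Ω).comp (jK.comp C)) (F := F) (fun c => by
          change jK (C (algebraMap F K c)) = g (jK (C (algebraMap F K c)))
          rw [hKC, AlgEquiv.commutes])
      replace hσ : ∀ x, g (jK (C x)) = jK (C (σ x)) := hσ
      have h1 : σ = 1 := by
        apply hξσ
        rw [hσ] at hg
        exact (C : K →+* LaurentSeries K).injective (jK.injective hg)
      intro k
      rw [hσ, h1, AlgEquiv.one_apply]
  obtain ⟨r, hr⟩ := exists_eq_algebraMap_mul_of_pow_eq_pow hζE hj0 (hKS.trans hFS.symm)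
  have hr0 : algebraMap E Ω r ≠ 0 := fun h => by
    rw [h, zero_mul, map_eq_zero] at hr
    simp at hr
  have htK : ∀ g, t g = 0 ↔ g (jK (single 1 1)) = jK (single 1 1) := fun g => by
    rw [ht0, hr, map_mul, AlgEquiv.commutes]
    exact (mul_right_inj' hr0).symm
  have htfix : ∀ g, t g = 0 → ∀ f, g (jF f) = jF f := fun g hg =>
    hFfix g ((ht0 g).mp hg) fun c => by rw [hFC, AlgEquiv.commutes]
  obtain ⟨H, hH⟩ := exists_subgroup_mem_iff htadd
  obtain ⟨τ, -, hτ⟩ : ∃ τ ∈ (⊤ : Subgroup (AbsGal E)), t τ = 1 := by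
    by_contra hcon
    obtain ⟨f, hf⟩ := exists_map_eq_of_fixed (algebraMap E Ω) (fun f => ⟨f, rfl⟩) ∅ (by simp)
      (z := jF (single 1 1)) (fun g _ => (ht0 g).mp (by
        by_contra hg
        exact hcon (exists_mem_eq_one htadd ⊤ (Subgroup.mem_top g) hg)))
    refine LaurentSeries.single_ne_pow hp.one_lt f ((algebraMap E Ω).injective ?_)
    rw [map_pow, hf, hFS]
  obtain ⟨σ₀, hσH, hκσ⟩ : ∃ σ ∈ H, κ σ = 1 := by
    by_contra hcon
    obtain ⟨f, hf⟩ := exists_map_eq_of_fixed jF hFE {jF (single 1 1)}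
      (by rintro _ rfl; exact ⟨_, rfl⟩) (z := jK (C ξ)) (fun g hg => (hκ0 g).mp (by
        by_contra hg'
        exact hcon (exists_mem_eq_one hκadd H ((hH g).mpr ((ht0 g).mpr (hg _ rfl))) hg')))
    obtain ⟨s, hs⟩ := LaurentSeries.exists_eq_C_of_pow_eq_C (n := p) (d := ζ) (v := f)
      (jF.injective (by rw [map_pow, hf, hZ, hFC]))
    exact hζp s hs
  have htwist : ∀ {δ : AbsGal E → ZMod p} {X : AbsGal E → ZMod (p ^ 2)},
      (∀ g h, δ (g * h) = δ g + δ h) →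
      (∀ g h, X (g * h) = X g + (1 + ZMod.mulPrime (δ g)) * X h) →
      (∀ g, ZMod.reduction p (X g) = t g) → (∀ g, ρ₂ g = 1 → δ g = 0 ∧ X g = 0) →
      ∀ g, t g = 0 → δ g = κ g := by
    intro δ X hδ hX hXt h1 g hg
    obtain ⟨y, hy, hy0⟩ := exists_cochain_of_cocycles ⊤ (fun g _ h _ => hX g h)
      (fun g _ h _ => hXT g h) (fun g _ => hXt g) (fun g _ => hXTt g)
    refine sub_eq_zero.mp (LaurentSeries.eq_zero_of_cup_eq_zero hodd hζE hFC hFE htadd ht htfix hτ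
      L (e := fun g => δ g - κ g) (y := y) (fun g h => ?_) (fun g h => ?_) (fun g hg => ?_)
      (fun g hg => ?_) g hg)
    · rw [hδ, hκadd]
      ring
    · exact hy g (Subgroup.mem_top g) h (Subgroup.mem_top h)
    · obtain ⟨h2, h3, -⟩ := hL g hg
      rw [(h1 g h2).1, (hκ0 g).mpr h3, sub_zero]
    · obtain ⟨h2, -, h3, -⟩ := hL g hg
      exact hy0 g (Subgroup.mem_top g) (h1 g h2).2 (hXT0 g h3)
  have hκ₁ := htwist hδ₁ hX₁ hr₁ fun g hg => ⟨(hδ g hg).1, (hX g hg).1⟩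
  have hκ₂ := htwist hδ₂ hX₂ hr₂ fun g hg => ⟨(hδ g hg).2, (hX g hg).2.1⟩
  obtain ⟨y, hy, hy0⟩ := exists_cochain_of_cocycles H (δ := fun g => δ₁ g + δ₂ g) (α := β)
    (fun g hg h hh => hX₃ g h ((hH g).mp hg) ((hH h).mp hh)) (fun g _ h _ => hXB g h)
    (fun g hg => hr₃ g ((hH g).mp hg)) (fun g _ => hXBβ g)
  obtain ⟨σ, c, s, hs⟩ := LaurentSeries.exists_eq_prod_mul_pow_of_cup_eq_zero hodd hζE hKC hKE
    htadd htK hκadd hκ0 (fun g h1 h2 => hKfix g ((htK g).mp h1) (hKC' g ((hκ0 g).mp h2)))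
    hb0 hB hβ ((hH σ₀).mp hσH) hκσ L (y := fun g => κ g * β g - y g) (fun g h hg hh => by
      have h1 := hy g ((hH g).mpr hg) h ((hH h).mpr hh)
      rw [hκ₁ g hg, hκ₂ g hg] at h1
      simp only [h1, hκadd, hβadd]
      ring) (fun g hg htg => by
      obtain ⟨h1, h2, -, h3⟩ := hL g hg
      simp only [hy0 g ((hH g).mpr htg) (hX g h1).2.2 (hXB0 g h3), (hκ0 g).mpr h2]
      ring)
  exact hb σ c s hs
end
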